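/- arXiv:2508.01349 — 4 statements merged into one kernel-verified Lean document; each statement's English description precedes it below -/
import Mathlib

section
/- If G is a polyhedron such that 1 ∉ A(G), then either G is isomorphic to the graph of the cube (the 3-dimensional hypercube graph Q₃), or G is a maximal planar graph, i.e., G has exactly 3p − 6 edges, where p is the number of vertices of G. -/
open SimpleGraph

/-- `H` is a minor of `G`: branch-set definition. -/
def SimpleGraph.HasMinor {V W : Type*} (G : SimpleGraph V) (H : SimpleGraph W) : Prop :=
  ∃ f : W → Set V,
    (∀ w, (G.induce (f w)).Connected) ∧
    (Pairwise fun w₁ w₂ => Disjoint (f w₁) (f w₂)) ∧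
    ∀ ⦃w₁ w₂⦄, H.Adj w₁ w₂ → ∃ v₁ ∈ f w₁, ∃ v₂ ∈ f w₂, G.Adj v₁ v₂

/-- Planarity à la Wagner: no `K₅` minor and no `K₃,₃` minor. -/
def SimpleGraph.IsPlanar {V : Type*} (G : SimpleGraph V) : Prop :=
  ¬ G.HasMinor (completeGraph (Fin 5)) ∧
  ¬ G.HasMinor (completeBipartiteGraph (Fin 3) (Fin 3))

/-- `G` is `k`-connected: it has at least `k + 1` vertices, and removing fewer
than `k` vertices always leaves a connected graph. -/
def SimpleGraph.IsKConnected {V : Type*} [Fintype V] (k : ℕ) (G : SimpleGraph V) : Prop :=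
  k + 1 ≤ Fintype.card V ∧
  ∀ S : Set V, S.ncard < k → ((⊤ : G.Subgraph).deleteVerts S).coe.Connected

/-- A polyhedron is a planar, 3-connected (finite simple) graph. -/
def SimpleGraph.IsPolyhedron {V : Type*} [Fintype V] (G : SimpleGraph V) : Prop :=
  G.IsPlanar ∧ G.IsKConnected 3

/-- `A(G)`: the set of numbers of common neighbours of pairs of distinct vertices. -/
def SimpleGraph.commA {V : Type*} (G : SimpleGraph V) : Set ℕ :=
  {a | ∃ u v : V, u ≠ v ∧ (G.commonNeighbors u v).ncard = a}

/-- The graph of the cube: the 3-dimensional hypercube graph `Q₃ = K₂ □ K₂ □ K₂`. -/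
def cubeGraph : SimpleGraph ((Fin 2 × Fin 2) × Fin 2) :=
  (completeGraph (Fin 2) □ completeGraph (Fin 2)) □ completeGraph (Fin 2)

namespace SimpleGraph

variable {V : Type*} {G : SimpleGraph V}

/-- The vertices that can be reached from `x` along edges whose far end avoids `S`; for `x ∉ S`
this is the vertex set of the component of `G - S` containing `x`. -/
def componentOff (G : SimpleGraph V) (S : Set V) (x : V) : Set V :=
  {y | Relation.ReflTransGen (fun u w => G.Adj u w ∧ w ∉ S) x y}

section componentOff

variable {S : Set V} {x y z : V}

lemma mem_componentOff_self : x ∈ G.componentOff S x := Relation.ReflTransGen.refl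

lemma notMem_of_mem_componentOff (hx : x ∉ S) (hy : y ∈ G.componentOff S x) : y ∉ S := by
  induction hy with
  | refl => exact hx
  | tail _ h _ => exact h.2

lemma mem_componentOff_of_adj (hy : y ∈ G.componentOff S x) (h : G.Adj y z) (hz : z ∉ S) :
    z ∈ G.componentOff S x := Relation.ReflTransGen.tail hy ⟨h, hz⟩

lemma componentOff_trans (hy : y ∈ G.componentOff S x) (hz : z ∈ G.componentOff S y) :
    z ∈ G.componentOff S x := Relation.ReflTransGen.trans hy hz

lemma mem_componentOff_symm (hx : x ∉ S) (hy : y ∈ G.componentOff S x) :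
    x ∈ G.componentOff S y := by
  induction hy with
  | refl => exact mem_componentOff_self
  | tail h₁ h₂ ih =>
    exact componentOff_trans (mem_componentOff_of_adj mem_componentOff_self h₂.1.symm
      (notMem_of_mem_componentOff hx h₁)) ih

lemma componentOff_eq (hx : x ∉ S) (hy : y ∈ G.componentOff S x) :
    G.componentOff S y = G.componentOff S x := by
  ext z
  exact ⟨componentOff_trans hy, componentOff_trans (mem_componentOff_symm hx hy)⟩

lemma disjoint_componentOff (h : y ∉ G.componentOff S x) (hy : y ∉ S) :
    Disjoint (G.componentOff S x) (G.componentOff S y) :=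
  Set.disjoint_left.2 fun _ hz hz' => h (componentOff_trans hz (mem_componentOff_symm hy hz'))

/-- A set containing `x` and closed under adjacency off `S` contains the component of `x`. -/
lemma componentOff_subset {X : Set V} (hx : x ∈ X)
    (h : ∀ u ∈ X, ∀ w, G.Adj u w → w ∉ S → w ∈ X) : G.componentOff S x ⊆ X := by
  intro y hy
  induction hy with
  | refl => exact hx
  | tail _ h₂ ih => exact h _ ih _ h₂.1 h₂.2

lemma connected_induce_componentOff : (G.induce (G.componentOff S x)).Connected := by
  rw [connected_iff_exists_forall_reachable]
  refine ⟨⟨x, mem_componentOff_self⟩, ?_⟩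
  rintro ⟨y, hy⟩
  induction hy with
  | refl => exact Reachable.refl _
  | tail h₁ h₂ ih => exact ih.trans (Adj.reachable (by simpa using h₂.1))

end componentOff

section Connected

lemma connected_induce_singleton (a : V) : (G.induce {a}).Connected := by
  have : Nonempty ({a} : Set V) := ⟨⟨a, rfl⟩⟩
  exact ⟨Preconnected.of_subsingleton⟩

lemma connected_induce_union_of_adj {s t : Set V} (hs : (G.induce s).Connected)
    (ht : (G.induce t).Connected) {a b : V} (ha : a ∈ s) (hb : b ∈ t) (h : G.Adj a b) :
    (G.induce (s ∪ t)).Connected :=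
  connected_induce_union hs.preconnected ht.preconnected ha hb h

lemma connected_induce_insert_of_adj {t : Set V} (ht : (G.induce t).Connected) {a b : V}
    (hb : b ∈ t) (h : G.Adj a b) : (G.induce (insert a t)).Connected := by
  rw [Set.insert_eq]
  exact connected_induce_union_of_adj (connected_induce_singleton a) ht rfl hb h

/-- Deleting fewer than `k` vertices from a `k`-connected graph leaves a single component. -/
lemma IsKConnected.mem_componentOff [Fintype V] {k : ℕ} (hG : G.IsKConnected k) {S : Set V}
    (hS : S.ncard < k) {x y : V} (hx : x ∉ S) (hy : y ∉ S) : y ∈ G.componentOff S x := by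
  obtain ⟨p⟩ := (hG.2 S hS).preconnected ⟨x, by simpa using hx⟩ ⟨y, by simpa using hy⟩
  suffices ∀ u v, (((⊤ : G.Subgraph).deleteVerts S).coe.Walk u v) →
      v.1 ∈ G.componentOff S u.1 from this _ _ p
  intro u v p
  induction p with
  | nil => exact mem_componentOff_self
  | @cons u v w h p ih =>
    refine componentOff_trans (mem_componentOff_of_adj mem_componentOff_self ?_ ?_) ih
    · exact ((⊤ : G.Subgraph).deleteVerts S).adj_sub h
    · simpa using v.2

/-- In a 3-connected graph, no two vertices separate `x` from `y`. -/
lemma IsKConnected.mem_of_closed [Fintype V] (hG : G.IsKConnected 3) {X : Set V} {a b x y : V}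
    (hx : x ∈ X) (hxa : x ≠ a) (hxb : x ≠ b) (hya : y ≠ a) (hyb : y ≠ b)
    (h : ∀ u ∈ X, ∀ w, G.Adj u w → w ≠ a → w ≠ b → w ∈ X) : y ∈ X := by
  have hS : ({a, b} : Set V).ncard < 3 := (Set.ncard_insert_le _ _).trans_lt (by simp)
  refine componentOff_subset hx ?_ (hG.mem_componentOff hS (x := x) (y := y) ?_ ?_)
  · intro u hu w huw hw
    simp only [Set.mem_insert_iff, Set.mem_singleton_iff, not_or] at hw
    exact h u hu w huw hw.1 hw.2
  · simp [hxa, hxb]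
  · simp [hya, hyb]

end Connected

section Minors

/-- A `K₃,₃` minor three of whose branch sets, on one side, are single vertices. -/
lemma IsPlanar.false_of_bipartite (hG : G.IsPlanar) {c d f : V} {P Q R : Set V}
    (hcd : c ≠ d) (hcf : c ≠ f) (hdf : d ≠ f)
    (hP : (G.induce P).Connected) (hQ : (G.induce Q).Connected) (hR : (G.induce R).Connected)
    (hPQ : Disjoint P Q) (hPR : Disjoint P R) (hQR : Disjoint Q R)
    (hP' : c ∉ P ∧ d ∉ P ∧ f ∉ P) (hQ' : c ∉ Q ∧ d ∉ Q ∧ f ∉ Q) (hR' : c ∉ R ∧ d ∉ R ∧ f ∉ R)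
    (aP : (∃ p ∈ P, G.Adj c p) ∧ (∃ p ∈ P, G.Adj d p) ∧ (∃ p ∈ P, G.Adj f p))
    (aQ : (∃ p ∈ Q, G.Adj c p) ∧ (∃ p ∈ Q, G.Adj d p) ∧ (∃ p ∈ Q, G.Adj f p))
    (aR : (∃ p ∈ R, G.Adj c p) ∧ (∃ p ∈ R, G.Adj d p) ∧ (∃ p ∈ R, G.Adj f p)) : False := by
  let A : Fin 3 → V := ![c, d, f]
  let B : Fin 3 → Set V := ![P, Q, R]
  have key : ∀ i j, A i ∉ B j ∧ ∃ p ∈ B j, G.Adj (A i) p := by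
    simp only [A, B, Fin.forall_fin_succ]
    simp_all
  refine hG.2 ⟨Sum.elim (fun i => {A i}) B, ?_, ?_, ?_⟩
  · rintro (i | i)
    · exact connected_induce_singleton _
    · fin_cases i <;> assumption
  · rintro (i | i) (j | j) hij
    · have : A i ≠ A j := by
        fin_cases i <;> fin_cases j <;> simp [A] at hij ⊢ <;> tauto
      simpa using this
    · simpa using (key i j).1
    · simpa using (key j i).1
    · fin_cases i <;> fin_cases j <;> simp [B] at hij ⊢ <;>
        first | assumption | exact Disjoint.symm ‹_›
  · rintro (i | i) (j | j) hij
    · simp at hij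
    · obtain ⟨p, hp, h⟩ := (key i j).2
      exact ⟨A i, rfl, p, hp, h⟩
    · obtain ⟨p, hp, h⟩ := (key j i).2
      exact ⟨p, hp, A j, rfl, h.symm⟩
    · simp at hij

/-- A `K₃,₃` minor all but one of whose branch sets are single vertices. -/
lemma IsPlanar.false_of_bipartite_set (hG : G.IsPlanar) {a b c d f : V} {Z : Set V}
    (hab : a ≠ b) (hcd : c ≠ d) (hcf : c ≠ f) (hdf : d ≠ f)
    (hac : G.Adj a c) (had : G.Adj a d) (haf : G.Adj a f)
    (hbc : G.Adj b c) (hbd : G.Adj b d) (hbf : G.Adj b f)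
    (hZ : (G.induce Z).Connected) (haZ : a ∉ Z) (hbZ : b ∉ Z)
    (hcZ : c ∉ Z) (hdZ : d ∉ Z) (hfZ : f ∉ Z)
    (hc : ∃ z ∈ Z, G.Adj c z) (hd : ∃ z ∈ Z, G.Adj d z) (hf : ∃ z ∈ Z, G.Adj f z) : False := by
  refine hG.false_of_bipartite (P := {a}) (Q := {b}) hcd hcf hdf
    (connected_induce_singleton a) (connected_induce_singleton b) hZ ?_ ?_ ?_ ?_ ?_ ⟨hcZ, hdZ, hfZ⟩
    ?_ ?_ ⟨hc, hd, hf⟩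
  · simpa using hab
  · simpa using haZ
  · simpa using hbZ
  · simpa using ⟨hac.ne', had.ne', haf.ne'⟩
  · simpa using ⟨hbc.ne', hbd.ne', hbf.ne'⟩
  · simpa using ⟨hac.symm, had.symm, haf.symm⟩
  · simpa using ⟨hbc.symm, hbd.symm, hbf.symm⟩

/-- Five connected, pairwise disjoint, pairwise adjacent vertex sets form a `K₅` minor. -/
lemma hasMinor_completeGraph {n : ℕ} (A : Fin n → Set V) (hA : ∀ i, (G.induce (A i)).Connected)
    (hd : ∀ i j, i < j → Disjoint (A i) (A j))
    (ha : ∀ i j, i < j → ∃ u ∈ A i, ∃ v ∈ A j, G.Adj u v) : G.HasMinor (completeGraph (Fin n)) := by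
  refine ⟨A, hA, ?_, ?_⟩
  · intro i j hij
    rcases lt_or_gt_of_ne hij with h | h
    · exact hd i j h
    · exact (hd j i h).symm
  · intro i j hij
    rcases lt_or_gt_of_ne hij with h | h
    · exact ha i j h
    · obtain ⟨u, hu, v, hv, huv⟩ := ha j i h
      exact ⟨v, hv, u, hu, huv.symm⟩

/-- A `K₅` minor with two adjacent vertices `a`, `b` and three further branch sets. -/
lemma IsPlanar.false_of_complete (hG : G.IsPlanar) {a b : V} {C D F : Set V}
    (hab : G.Adj a b) (hC : (G.induce C).Connected) (hD : (G.induce D).Connected)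
    (hF : (G.induce F).Connected) (hCD : Disjoint C D) (hCF : Disjoint C F) (hDF : Disjoint D F)
    (ha : a ∉ C ∧ a ∉ D ∧ a ∉ F) (hb : b ∉ C ∧ b ∉ D ∧ b ∉ F)
    (aa : (∃ v ∈ C, G.Adj a v) ∧ (∃ v ∈ D, G.Adj a v) ∧ (∃ v ∈ F, G.Adj a v))
    (ab : (∃ v ∈ C, G.Adj b v) ∧ (∃ v ∈ D, G.Adj b v) ∧ (∃ v ∈ F, G.Adj b v))
    (aCD : ∃ u ∈ C, ∃ v ∈ D, G.Adj u v) (aCF : ∃ u ∈ C, ∃ v ∈ F, G.Adj u v)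
    (aDF : ∃ u ∈ D, ∃ v ∈ F, G.Adj u v) : False := by
  have := hab.ne
  refine hG.1 (hasMinor_completeGraph ![{a}, {b}, C, D, F] ?_ ?_ ?_)
  · intro i
    fin_cases i
    · exact connected_induce_singleton a
    · exact connected_induce_singleton b
    · exact hC
    · exact hD
    · exact hF
  · simp only [Fin.forall_fin_succ]
    simp_all
  · simp only [Fin.forall_fin_succ]
    simp_all

end Minors

end SimpleGraph

namespace SimpleGraph

variable {V : Type*} {G : SimpleGraph V}

/-- A triangle whose removal leaves at most one component. -/
def IsFacialTriangle (G : SimpleGraph V) (a b c : V) : Prop :=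
  G.Adj a b ∧ G.Adj a c ∧ G.Adj b c ∧
    ∀ x y, x ∉ ({a, b, c} : Set V) → y ∉ ({a, b, c} : Set V) → y ∈ G.componentOff {a, b, c} x

lemma IsFacialTriangle.swap_left {a b c : V} (h : G.IsFacialTriangle a b c) :
    G.IsFacialTriangle b a c := by
  obtain ⟨h₁, h₂, h₃, h₄⟩ := h
  refine ⟨h₁.symm, h₃, h₂, ?_⟩
  rwa [Set.insert_comm]

lemma IsFacialTriangle.swap_right {a b c : V} (h : G.IsFacialTriangle a b c) :
    G.IsFacialTriangle a c b := by
  obtain ⟨h₁, h₂, h₃, h₄⟩ := h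
  refine ⟨h₂, h₁, h₃.symm, ?_⟩
  rwa [Set.pair_comm]

/-- A vertex reachable from `c` off `S'` is adjacent to `c` or linked to it by a component off
`S' ∪ {c, d}`. -/
lemma exists_link {S S' : Set V} {c d : V} (hS : ∀ x, x ∈ S ↔ x ∈ S' ∨ x = c ∨ x = d)
    (hcd : c ≠ d) (h : d ∈ G.componentOff S' c) :
    ∃ Z : Set V, (∀ z ∈ Z, z ∉ S) ∧ (G.induce (insert c Z)).Connected ∧
      (∃ u ∈ insert c Z, G.Adj u d) ∧
      ∀ z ∈ Z, Z = G.componentOff S z ∧ (∃ u ∈ Z, G.Adj c u) ∧ (∃ u ∈ Z, G.Adj d u) := by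
  by_cases hadj : G.Adj c d
  · exact ⟨∅, by simp, by rw [insert_empty_eq]; exact connected_induce_singleton c,
      ⟨c, by simp, hadj⟩, by simp⟩
  by_cases hz : ∃ z ∉ S, (∃ u ∈ G.componentOff S z, G.Adj c u) ∧
      (∃ u ∈ G.componentOff S z, G.Adj d u)
  · obtain ⟨z, hz, ⟨u, hu, hcu⟩, ⟨w, hw, hdw⟩⟩ := hz
    refine ⟨G.componentOff S z, fun x => notMem_of_mem_componentOff hz,
      connected_induce_insert_of_adj connected_induce_componentOff hu hcu,
      ⟨w, Or.inr hw, hdw.symm⟩, fun x hx => ⟨(componentOff_eq hz hx).symm, ⟨u, hu, hcu⟩,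
      ⟨w, hw, hdw⟩⟩⟩
  push Not at hz
  exfalso
  have key : G.componentOff S' c ⊆ {y | y = c ∨ y ∉ S ∧ ∃ u ∈ G.componentOff S y, G.Adj c u} := by
    refine componentOff_subset (Or.inl rfl) ?_
    rintro y hy w hyw hw
    by_cases hwc : w = c
    · exact Or.inl hwc
    right
    rcases hy with rfl | ⟨hyS, u, hu, hcu⟩
    · have hwd : w ≠ d := fun h => hadj (h ▸ hyw)
      exact ⟨by rw [hS]; tauto, w, mem_componentOff_self, hyw⟩
    · have hwd : w ≠ d := fun h => hz y hyS ⟨u, hu, hcu⟩ y mem_componentOff_self (h ▸ hyw.symm)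
      have hwS : w ∉ S := by rw [hS]; tauto
      have : w ∈ G.componentOff S y := mem_componentOff_of_adj mem_componentOff_self hyw hwS
      exact ⟨hwS, u, by rwa [componentOff_eq hyS this], hcu⟩
  rcases key h with h | h
  · exact hcd h.symm
  · exact h.1 (by rw [hS]; tauto)

/-- An edge of a planar graph lies in at most two facial triangles. -/
lemma IsPlanar.false_of_three_facial (hG : G.IsPlanar) {a b c d f : V}
    (hc : G.IsFacialTriangle a b c) (hd : G.IsFacialTriangle a b d)
    (hf : G.IsFacialTriangle a b f) (hcd : c ≠ d) (hcf : c ≠ f) (hdf : d ≠ f) : False := by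
  obtain ⟨hab, hac, hbc, hc'⟩ := hc
  obtain ⟨-, had, hbd, hd'⟩ := hd
  obtain ⟨-, haf, hbf, hf'⟩ := hf
  have h₁ := hac.ne; have h₂ := hbc.ne; have h₃ := had.ne; have h₄ := hbd.ne
  have h₅ := haf.ne; have h₆ := hbf.ne
  set S : Set V := {a, b, c, d, f} with hS
  by_cases hz : ∃ z ∉ S, (∃ u ∈ G.componentOff S z, G.Adj c u) ∧
      (∃ u ∈ G.componentOff S z, G.Adj d u) ∧ (∃ u ∈ G.componentOff S z, G.Adj f u)
  · obtain ⟨z, hz, hzc, hzd, hzf⟩ := hz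
    have hn : ∀ x ∈ S, x ∉ G.componentOff S z := fun x hx hx' =>
      notMem_of_mem_componentOff hz hx' hx
    exact hG.false_of_bipartite_set hab.ne hcd hcf hdf hac had haf hbc hbd hbf
      connected_induce_componentOff (hn a (by simp [hS])) (hn b (by simp [hS]))
      (hn c (by simp [hS])) (hn d (by simp [hS])) (hn f (by simp [hS])) hzc hzd hzf
  obtain ⟨X, hXS, hXc, ⟨x, hx, hxd⟩, hX⟩ := exists_link (S := S) (S' := {a, b, f}) (c := c)
    (d := d) (by intro x; simp only [hS, Set.mem_insert_iff, Set.mem_singleton_iff]; tauto) hcd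
    (hf' c d (by simp [h₁.symm, h₂.symm, hcf]) (by simp [h₃.symm, h₄.symm, hdf]))
  obtain ⟨Y, hYS, hYc, ⟨y, hy, hyf⟩, hY⟩ := exists_link (S := S) (S' := {a, b, c}) (c := d)
    (d := f) (by intro x; simp only [hS, Set.mem_insert_iff, Set.mem_singleton_iff]; tauto) hdf
    (hc' d f (by simp [h₃.symm, h₄.symm, hcd.symm]) (by simp [h₅.symm, h₆.symm, hcf.symm]))
  obtain ⟨W, hWS, hWc, ⟨w, hw, hwc⟩, hW⟩ := exists_link (S := S) (S' := {a, b, d}) (c := f)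
    (d := c) (by intro x; simp only [hS, Set.mem_insert_iff, Set.mem_singleton_iff]; tauto) hcf.symm
    (hd' f c (by simp [h₅.symm, h₆.symm, hdf.symm]) (by simp [h₁.symm, h₂.symm, hcd]))
  have dXY : ∀ z ∈ X, z ∉ Y := fun z hzX hzY => hz ⟨z, hXS z hzX,
    by rw [← (hX z hzX).1]; exact (hX z hzX).2.1, by rw [← (hX z hzX).1]; exact (hX z hzX).2.2,
    by rw [← (hY z hzY).1]; exact (hY z hzY).2.2⟩
  have dXW : ∀ z ∈ X, z ∉ W := fun z hzX hzW => hz ⟨z, hXS z hzX,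
    by rw [← (hX z hzX).1]; exact (hX z hzX).2.1, by rw [← (hX z hzX).1]; exact (hX z hzX).2.2,
    by rw [← (hW z hzW).1]; exact (hW z hzW).2.1⟩
  have dYW : ∀ z ∈ Y, z ∉ W := fun z hzY hzW => hz ⟨z, hYS z hzY,
    by rw [← (hW z hzW).1]; exact (hW z hzW).2.2, by rw [← (hY z hzY).1]; exact (hY z hzY).2.1,
    by rw [← (hY z hzY).1]; exact (hY z hzY).2.2⟩
  have nX : ∀ s ∈ S, s ∉ X := fun s hs hs' => hXS s hs' hs
  have nY : ∀ s ∈ S, s ∉ Y := fun s hs hs' => hYS s hs' hs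
  have nW : ∀ s ∈ S, s ∉ W := fun s hs hs' => hWS s hs' hs
  refine hG.false_of_complete hab hXc hYc hWc ?_ ?_ ?_ ?_ ?_
    ⟨⟨c, by simp, hac⟩, ⟨d, by simp, had⟩, ⟨f, by simp, haf⟩⟩
    ⟨⟨c, by simp, hbc⟩, ⟨d, by simp, hbd⟩, ⟨f, by simp, hbf⟩⟩
    ⟨x, hx, d, by simp, hxd⟩ ⟨c, by simp, w, hw, hwc.symm⟩ ⟨y, hy, f, by simp, hyf⟩
  · rw [Set.disjoint_left]
    rintro z (rfl | hz') (rfl | hz'')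
    · exact hcd rfl
    · exact nY _ (by simp [hS]) hz''
    · exact nX _ (by simp [hS]) hz'
    · exact dXY z hz' hz''
  · rw [Set.disjoint_left]
    rintro z (rfl | hz') (rfl | hz'')
    · exact hcf rfl
    · exact nW _ (by simp [hS]) hz''
    · exact nX _ (by simp [hS]) hz'
    · exact dXW z hz' hz''
  · rw [Set.disjoint_left]
    rintro z (rfl | hz') (rfl | hz'')
    · exact hdf rfl
    · exact nW _ (by simp [hS]) hz''
    · exact nY _ (by simp [hS]) hz'
    · exact dYW z hz' hz''
  · simp only [Set.mem_insert_iff, not_or]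
    exact ⟨⟨hac.ne, nX a (by simp [hS])⟩, ⟨had.ne, nY a (by simp [hS])⟩, haf.ne, nW a (by simp [hS])⟩
  · simp only [Set.mem_insert_iff, not_or]
    exact ⟨⟨hbc.ne, nX b (by simp [hS])⟩, ⟨hbd.ne, nY b (by simp [hS])⟩, hbf.ne, nW b (by simp [hS])⟩

/-- Each vertex of a separating triangle has a neighbour in each component. -/
lemma IsKConnected.exists_adj_componentOff [Fintype V] (hG : G.IsKConnected 3) {a b c l m : V}
    (hl : l ∉ ({a, b, c} : Set V)) (hm : m ∉ ({a, b, c} : Set V))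
    (hlm : m ∉ G.componentOff {a, b, c} l) : ∃ u ∈ G.componentOff {a, b, c} l, G.Adj u a := by
  by_contra! hcon
  simp only [Set.mem_insert_iff, Set.mem_singleton_iff, not_or] at hl hm
  refine hlm (hG.mem_of_closed (a := b) (b := c) mem_componentOff_self hl.2.1 hl.2.2 hm.2.1 hm.2.2
    fun u hu w huw hwb hwc => mem_componentOff_of_adj hu huw ?_)
  have hwa : w ≠ a := fun h => hcon u hu (h ▸ huw)
  simp [hwa, hwb, hwc]

lemma mem_of_adj_componentOff {a b c l u w : V} (hu : u ∈ G.componentOff {a, b, c} l)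
    (h : G.Adj u w) : w = a ∨ w = b ∨ w = c ∨ w ∈ G.componentOff {a, b, c} l := by
  by_cases hw : w ∈ ({a, b, c} : Set V)
  · simp only [Set.mem_insert_iff, Set.mem_singleton_iff] at hw
    tauto
  · exact Or.inr (Or.inr (Or.inr (mem_componentOff_of_adj hu h hw)))

variable [Fintype V]

/-- When two vertices never have exactly one common neighbour, every component of the complement
of a separating triangle `a b c` contains a common neighbour of `a` and `b`. -/
lemma IsPolyhedron.exists_commonNeighbor_componentOff (hG : G.IsPolyhedron)
    (h : ∀ ⦃u v w⦄, u ≠ v → G.Adj w u → G.Adj w v → ∃ w', w' ≠ w ∧ G.Adj w' u ∧ G.Adj w' v)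
    {a b c l m : V} (hab : G.Adj a b) (hac : G.Adj a c) (hbc : G.Adj b c)
    (hl : l ∉ ({a, b, c} : Set V)) (hm : m ∉ ({a, b, c} : Set V))
    (hlm : m ∉ G.componentOff {a, b, c} l) :
    ∃ u ∈ G.componentOff {a, b, c} l, G.Adj u a ∧ G.Adj u b := by
  by_contra! hcon
  set L := G.componentOff {a, b, c} l with hL
  have hml : l ∉ G.componentOff {a, b, c} m := fun hh => hlm (mem_componentOff_symm hm hh)
  have hdisj := disjoint_componentOff (G := G) hlm hm
  have hba : ({a, b, c} : Set V) = {b, a, c} := Set.insert_comm _ _ _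
  obtain ⟨p, hp, hpa⟩ := hG.2.exists_adj_componentOff hl hm hlm
  obtain ⟨y, hy, hya⟩ := hG.2.exists_adj_componentOff hm hl hml
  obtain ⟨q, hq, hqb⟩ := hG.2.exists_adj_componentOff (hba ▸ hl) (hba ▸ hm) (hba ▸ hlm)
  obtain ⟨t, ht, htb⟩ := hG.2.exists_adj_componentOff (hba ▸ hm) (hba ▸ hl) (hba ▸ hml)
  rw [← hba, ← hL] at hq
  rw [← hba] at ht
  have nL : ∀ u ∈ L, u ≠ a ∧ u ≠ b ∧ u ≠ c := fun u hu => by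
    have := notMem_of_mem_componentOff hl hu
    simpa using this
  -- common neighbours of vertices in different components lie on the triangle
  have cross : ∀ {u v w}, u ∈ L → v ∈ G.componentOff {a, b, c} m → G.Adj w u → G.Adj w v →
      w = a ∨ w = b ∨ w = c := by
    intro u v w hu hv hwu hwv
    have h₁ := mem_of_adj_componentOff hu hwu.symm
    have h₂ := mem_of_adj_componentOff hv hwv.symm
    have h₃ : w ∈ L → w ∉ G.componentOff {a, b, c} m := fun hh => Set.disjoint_left.1 hdisj hh
    tauto
  have Pc : ∀ u ∈ L, G.Adj u a → G.Adj u c := by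
    intro u hu hua
    have huy : u ≠ y := fun hh => Set.disjoint_left.1 hdisj hu (hh ▸ hy)
    obtain ⟨r, hra, hru, hry⟩ := h huy hua.symm hya.symm
    rcases cross hu hy hru hry with rfl | rfl | rfl
    · exact absurd rfl hra
    · exact absurd hru.symm (hcon u hu hua)
    · exact hru.symm
  have Qc : ∀ u ∈ L, G.Adj u b → G.Adj u c := by
    intro u hu hub
    have huy : u ≠ t := fun hh => Set.disjoint_left.1 hdisj hu (hh ▸ ht)
    obtain ⟨r, hrb, hru, hry⟩ := h huy hub.symm htb.symm
    rcases cross hu ht hru hry with rfl | rfl | rfl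
    · exact absurd hru.symm (fun hh => hcon u hu hh hub)
    · exact absurd rfl hrb
    · exact hru.symm
  obtain ⟨p', hp'c, hp'p, hp'a⟩ := h hpa.ne (Pc p hp hpa).symm hac.symm
  have hp' : p' ∈ L := by
    rcases mem_of_adj_componentOff hp hp'p.symm with rfl | rfl | rfl | hh
    · exact absurd rfl hp'a.ne
    · exact absurd hp'p.symm (hcon p hp hpa)
    · exact absurd rfl hp'c
    · exact hh
  obtain ⟨q', hq'c, hq'q, hq'b⟩ := h hqb.ne (Qc q hq hqb).symm hbc.symm
  have hq' : q' ∈ L := by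
    rcases mem_of_adj_componentOff hq hq'q.symm with rfl | rfl | rfl | hh
    · exact absurd hqb (hcon q hq hq'q.symm)
    · exact absurd rfl hq'b.ne
    · exact absurd rfl hq'c
    · exact hh
  have join : ∀ u ∈ L, ∀ v ∈ L, G.Adj u a → G.Adj v b →
      ∃ z ∈ L, G.Adj z u ∧ G.Adj z v := by
    intro u hu v hv hua hvb
    have huv : u ≠ v := fun hh => hcon u hu hua (hh ▸ hvb)
    obtain ⟨z, hzc, hzu, hzv⟩ := h huv (Pc u hu hua).symm (Qc v hv hvb).symm
    refine ⟨z, ?_, hzu, hzv⟩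
    rcases mem_of_adj_componentOff hu hzu.symm with rfl | rfl | rfl | hh
    · exact absurd hvb (hcon v hv hzv.symm)
    · exact absurd hzu.symm (hcon u hu hua)
    · exact absurd rfl hzc
    · exact hh
  -- the minor obtained from adjacent `u`, `u'` and a connected set `Z` reaching `b`
  have minor : ∀ u ∈ L, ∀ u' ∈ L, G.Adj u a → G.Adj u' a → u ≠ u' → ∀ Z ⊆ L,
      (G.induce Z).Connected → u ∉ Z → u' ∉ Z → (∃ z ∈ Z, G.Adj u z) → (∃ z ∈ Z, G.Adj u' z) →
      (∃ z ∈ Z, G.Adj b z) → False := by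
    intro u hu u' hu' hua hu'a hne Z hZL hZ huZ hu'Z hz hz' hzb
    have nZ : a ∉ Z ∧ b ∉ Z ∧ c ∉ Z := by
      refine ⟨fun hh => ?_, fun hh => ?_, fun hh => ?_⟩ <;> have := nL _ (hZL hh) <;> tauto
    exact hG.1.false_of_bipartite_set hac.ne hne (nL u hu).2.1 (nL u' hu').2.1 hua.symm hu'a.symm
      hab (Pc u hu hua).symm (Pc u' hu' hu'a).symm hbc.symm hZ nZ.1 nZ.2.2 huZ hu'Z nZ.2.1 hz hz' hzb
  -- the same with `p`, `p'` interchangeable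
  have step : ∀ u ∈ L, ∀ u' ∈ L, G.Adj u a → G.Adj u' a → u ≠ u' → ¬ G.Adj u q := by
    intro u hu u' hu' hua hu'a hne huq
    obtain ⟨z, hz, hzu', hzq'⟩ := join u' hu' q' hq' hu'a hq'b.symm.symm
    by_cases hzu : z = u
    · subst hzu
      exact hG.1.false_of_bipartite_set (a := b) (b := c) (c := q) (d := q') (f := a)
        (Z := {z}) hbc.ne hq'q.ne' (nL q hq).1 (nL q' hq').1 hqb.symm
        hq'b.symm hab.symm (Qc q hq hqb).symm (Qc q' hq' hq'b).symm hac.symm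
        (connected_induce_singleton z) (by simpa using (nL z hz).2.1.symm)
        (by simpa using (nL z hz).2.2.symm) (by simpa using huq.ne') (by simpa using hzq'.ne')
        (by simpa using (nL z hz).1.symm) (by simpa using huq.symm) (by simpa using hzq'.symm)
        (by simpa using hua.symm)
    · refine minor u hu u' hu' hua hu'a hne {z, q', q} ?_ ?_ ?_ ?_ ⟨q, by simp, huq⟩
        ⟨z, by simp, hzu'.symm⟩ ⟨q, by simp, hqb.symm⟩
      · simp [Set.insert_subset_iff, hz, hq, hq']
      · exact connected_induce_insert_of_adj (induce_pair_connected_of_adj hq'q) (by simp) hzq'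
      · have h₁ : u ≠ q := huq.ne
        have h₂ : u ≠ q' := fun hh => hcon u hu hua (hh ▸ hq'b)
        simp [h₁, h₂, Ne.symm hzu]
      · have h₁ : u' ≠ q := fun hh => hcon u' hu' hu'a (hh ▸ hqb)
        have h₂ : u' ≠ q' := fun hh => hcon u' hu' hu'a (hh ▸ hq'b)
        simp [h₁, h₂, hzu'.ne']
  obtain ⟨z₁, hz₁, hz₁p', hz₁q⟩ := join p' hp' q hq hp'a hqb
  obtain ⟨z₂, hz₂, hz₂p, hz₂q⟩ := join p hp q hq hpa hqb
  by_cases h₁ : z₁ = p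
  · exact step p hp p' hp' hpa hp'a hp'p.ne' (h₁ ▸ hz₁q)
  by_cases h₂ : z₂ = p'
  · exact step p' hp' p hp hp'a hpa hp'p.ne (h₂ ▸ hz₂q)
  refine minor p hp p' hp' hpa hp'a hp'p.ne' {z₁, z₂, q} ?_ ?_ ?_ ?_ ⟨z₂, by simp, hz₂p.symm⟩
    ⟨z₁, by simp, hz₁p'.symm⟩ ⟨q, by simp, hqb.symm⟩
  · simp [Set.insert_subset_iff, hz₁, hq, hz₂]
  · exact connected_induce_insert_of_adj (induce_pair_connected_of_adj hz₂q) (b := q)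
      (by simp) hz₁q
  · have h₃ : p ≠ q := fun hh => hcon p hp hpa (hh ▸ hqb)
    simp [h₃, Ne.symm h₁, hz₂p.ne']
  · have h₃ : p' ≠ q := fun hh => hcon p' hp' hp'a (hh ▸ hqb)
    simp [h₃, Ne.symm h₂, hz₁p'.ne']

omit [Fintype V] in
lemma not_isFacialTriangle_iff {a b c : V} (hab : G.Adj a b) (hac : G.Adj a c)
    (hbc : G.Adj b c) : ¬ G.IsFacialTriangle a b c ↔ ∃ l m, l ∉ ({a, b, c} : Set V) ∧
      m ∉ ({a, b, c} : Set V) ∧ m ∉ G.componentOff {a, b, c} l := by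
  simp only [IsFacialTriangle, hab, hac, hbc, true_and]
  push Not
  exact ⟨fun ⟨l, m, h⟩ => ⟨l, m, h⟩, fun ⟨l, m, h⟩ => ⟨l, m, h⟩⟩

/-- Each component of the complement of a separating triangle `a b c` contains the apex of a facial
triangle on `a b`. -/
lemma IsPolyhedron.exists_facial_componentOff (hG : G.IsPolyhedron)
    (h : ∀ ⦃u v w⦄, u ≠ v → G.Adj w u → G.Adj w v → ∃ w', w' ≠ w ∧ G.Adj w' u ∧ G.Adj w' v)
    {a b : V} (hab : G.Adj a b) (n : ℕ) : ∀ c l m : V, G.Adj a c → G.Adj b c →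
    l ∉ ({a, b, c} : Set V) → m ∉ ({a, b, c} : Set V) → m ∉ G.componentOff {a, b, c} l →
    (G.componentOff {a, b, c} l).ncard ≤ n →
    ∃ d ∈ G.componentOff {a, b, c} l, G.IsFacialTriangle a b d := by
  induction n with
  | zero =>
    intro c l m _ _ _ _ _ hn
    rw [Nat.le_zero, Set.ncard_eq_zero (Set.toFinite _)] at hn
    exact absurd (mem_componentOff_self (G := G) (S := {a, b, c}) (x := l)) (by rw [hn]; simp)
  | succ n ih =>
    intro c l m hac hbc hl hm hlm hn
    obtain ⟨u, hu, hua, hub⟩ := hG.exists_commonNeighbor_componentOff h hab hac hbc hl hm hlm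
    by_cases hf : G.IsFacialTriangle a b u
    · exact ⟨u, hu, hf⟩
    obtain ⟨s, t, hs, ht, hst⟩ := (not_isFacialTriangle_iff hab hua.symm hub.symm).1 hf
    have huc : u ∉ ({a, b, c} : Set V) := notMem_of_mem_componentOff hl hu
    have hcu : c ∉ ({a, b, u} : Set V) := by
      have h₁ := hac.ne'; have h₂ := hbc.ne'
      simp only [Set.mem_insert_iff, Set.mem_singleton_iff, not_or] at huc ⊢
      exact ⟨h₁, h₂, Ne.symm huc.2.2⟩
    -- a component of the complement of `a b u` missing `c`
    obtain ⟨w, hw, hwc⟩ : ∃ w, w ∉ ({a, b, u} : Set V) ∧ w ∉ G.componentOff {a, b, u} c := by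
      by_contra! hall
      exact hst (componentOff_trans (mem_componentOff_symm hcu (hall s hs)) (hall t ht))
    have hcw : c ∉ G.componentOff {a, b, u} w := fun hh => hwc (mem_componentOff_symm hw hh)
    have hrot : ({a, b, u} : Set V) = {u, a, b} := by
      ext; simp only [Set.mem_insert_iff, Set.mem_singleton_iff]; tauto
    obtain ⟨x, hx, hxu⟩ := hG.2.exists_adj_componentOff (hrot ▸ hw) (hrot ▸ hcu) (hrot ▸ hcw)
    rw [← hrot] at hx
    have off : ∀ y ∈ G.componentOff {a, b, u} w, y ∉ ({a, b, c} : Set V) := by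
      intro y hy
      have h₁ := notMem_of_mem_componentOff hw hy
      have h₂ : y ≠ c := fun hh => hcw (hh ▸ hy)
      simp only [Set.mem_insert_iff, Set.mem_singleton_iff] at h₁ ⊢
      tauto
    have hsub : G.componentOff {a, b, u} w ⊆ G.componentOff {a, b, c} l := by
      rw [← componentOff_eq hw hx]
      have : G.componentOff {a, b, u} x ⊆
          G.componentOff {a, b, u} w ∩ G.componentOff {a, b, c} l := by
        refine componentOff_subset ⟨hx, mem_componentOff_of_adj hu hxu.symm (off x hx)⟩ ?_
        rintro y ⟨hy, hy'⟩ z hyz hz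
        have := mem_componentOff_of_adj hy hyz hz
        exact ⟨this, mem_componentOff_of_adj hy' hyz (off z this)⟩
      exact this.trans Set.inter_subset_right
    have hlt : (G.componentOff {a, b, u} w).ncard < (G.componentOff {a, b, c} l).ncard := by
      refine Set.ncard_lt_ncard ⟨hsub, fun hh => ?_⟩ (Set.toFinite _)
      exact notMem_of_mem_componentOff hw (hh hu) (by simp)
    obtain ⟨d, hd, hd'⟩ := ih u w c hua.symm hub.symm hw hcu hcw (by omega)
    exact ⟨d, hsub hd, hd'⟩

/-- Every edge lying in a triangle lies in two facial triangles. -/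
lemma IsPolyhedron.exists_two_facial (hG : G.IsPolyhedron)
    (h : ∀ ⦃u v w⦄, u ≠ v → G.Adj w u → G.Adj w v → ∃ w', w' ≠ w ∧ G.Adj w' u ∧ G.Adj w' v)
    {a b c : V} (hab : G.Adj a b) (hac : G.Adj a c) (hbc : G.Adj b c) :
    ∃ d f, d ≠ f ∧ G.IsFacialTriangle a b d ∧ G.IsFacialTriangle a b f := by
  have sep : ∀ c, G.Adj a c → G.Adj b c → ¬ G.IsFacialTriangle a b c →
      ∃ d f, d ≠ f ∧ G.IsFacialTriangle a b d ∧ G.IsFacialTriangle a b f := by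
    intro c hac hbc hf
    obtain ⟨l, m, hl, hm, hlm⟩ := (not_isFacialTriangle_iff hab hac hbc).1 hf
    have hml : l ∉ G.componentOff {a, b, c} m := fun hh => hlm (mem_componentOff_symm hm hh)
    obtain ⟨d, hd, hd'⟩ := hG.exists_facial_componentOff h hab _ c l m hac hbc hl hm hlm le_rfl
    obtain ⟨f, hf, hf'⟩ := hG.exists_facial_componentOff h hab _ c m l hac hbc hm hl hml le_rfl
    exact ⟨d, f, (disjoint_componentOff hlm hm).ne_of_mem hd hf, hd', hf'⟩
  obtain ⟨c', hne, hac', hbc'⟩ := h hab.ne hac.symm hbc.symm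
  by_cases h₁ : G.IsFacialTriangle a b c
  · by_cases h₂ : G.IsFacialTriangle a b c'
    · exact ⟨c, c', hne.symm, h₁, h₂⟩
    · exact sep c' hac'.symm hbc'.symm h₂
  · exact sep c hac hbc h₁

end SimpleGraph

namespace SimpleGraph

variable {V : Type*} {G : SimpleGraph V}

/-- The interior of a path between nonadjacent vertices is connected and adjacent to both ends. -/
lemma Walk.IsPath.exists_interior {x y : V} {p : G.Walk x y} (hp : p.IsPath) (hne : x ≠ y)
    (hadj : ¬ G.Adj x y) : ∃ P : Set V, (G.induce P).Connected ∧
      (∀ z ∈ P, z ∈ p.support ∧ z ≠ x ∧ z ≠ y) ∧ (∃ z ∈ P, G.Adj x z) ∧ ∃ z ∈ P, G.Adj y z := by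
  cases p with
  | nil => exact absurd rfl hne
  | @cons _ w _ hxw q =>
    rw [Walk.cons_isPath_iff] at hp
    obtain ⟨hq, hxq⟩ := hp
    have hqr : q.reverse.IsPath := hq.reverse
    have hmem : ∀ z, z ∈ q.support ↔ z ∈ q.reverse.support := by simp
    revert hqr hmem
    generalize q.reverse = r
    intro hr hmem
    cases r with
    | nil => exact absurd hxw hadj
    | @cons _ u _ hyu r =>
      rw [Walk.cons_isPath_iff] at hr
      refine ⟨{z | z ∈ r.support}, r.connected_induce_support, ?_, ⟨w, by simp, hxw⟩,
        ⟨u, by simp, hyu⟩⟩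
      intro z hz
      have hzq : z ∈ q.support := by rw [hmem]; simp [show z ∈ r.support from hz]
      refine ⟨by simp [hzq], ?_, ?_⟩
      · rintro rfl; exact hxq hzq
      · rintro rfl; exact hr.2 hz

/-- Two nonadjacent vertices of a cycle split the rest of it into two connected parts. -/
lemma IsCycles.exists_arcs [Finite V] (hG : G.IsCycles) {x y : V} (hne : x ≠ y)
    (hadj : ¬ G.Adj x y) (hxy : G.Reachable x y) : ∃ P Q : Set V,
      (G.induce P).Connected ∧ (G.induce Q).Connected ∧ Disjoint P Q ∧
      (∀ z ∈ P ∪ Q, G.Reachable x z ∧ z ≠ x ∧ z ≠ y) ∧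
      ((∃ z ∈ P, G.Adj x z) ∧ ∃ z ∈ P, G.Adj y z) ∧
      ((∃ z ∈ Q, G.Adj x z) ∧ ∃ z ∈ Q, G.Adj y z) := by
  classical
  have hnb : (G.neighborSet x).Nonempty := by
    obtain ⟨p⟩ := hxy
    cases p with
    | nil => exact absurd rfl hne
    | cons h _ => exact ⟨_, h⟩
  obtain ⟨p, hp, hpv⟩ := hG.exists_cycle_toSubgraph_verts_eq_connectedComponentSupp
    (c := G.connectedComponentMk x) rfl hnb
  have hy : y ∈ p.support := by
    rw [← Walk.mem_verts_toSubgraph, hpv]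
    exact (ConnectedComponent.eq.2 hxy).symm
  have hreach : ∀ z ∈ p.support, G.Reachable x z := fun z hz =>
    (p.takeUntil z hz).reachable
  have hnd := hp.support_nodup
  have hspec := p.take_spec hy
  have hsub₁ := p.support_takeUntil_subset_support hy
  have hsub₂ := p.support_dropUntil_subset_support hy
  revert hspec hsub₁ hsub₂
  generalize p.takeUntil y hy = q
  generalize p.dropUntil y hy = r
  intro hspec hsub₁ hsub₂
  rw [← hspec, Walk.tail_support_append, List.nodup_append'] at hnd
  obtain ⟨hq, hr, hqr⟩ := hnd
  have hqt : ∀ z ∈ q.support, z ≠ x → z ∈ q.support.tail := by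
    intro z hz hzx
    rw [← q.cons_tail_support, List.mem_cons] at hz
    exact hz.resolve_left hzx
  have hrt : ∀ z ∈ r.support, z ≠ y → z ∈ r.support.tail := by
    intro z hz hzy
    rw [← r.cons_tail_support, List.mem_cons] at hz
    exact hz.resolve_left hzy
  have hqp : q.IsPath := by
    rw [Walk.isPath_def, ← Walk.cons_tail_support, List.nodup_cons]
    exact ⟨fun h => hqr h (hrt x (by simp) hne), hq⟩
  have hrp : r.IsPath := by
    rw [Walk.isPath_def, ← Walk.cons_tail_support, List.nodup_cons]
    exact ⟨fun h => hqr (hqt y (by simp) hne.symm) h, hr⟩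
  obtain ⟨P, hP, hPs, hxP, hyP⟩ := hqp.exists_interior hne hadj
  obtain ⟨Q, hQ, hQs, hyQ, hxQ⟩ := hrp.exists_interior hne.symm (fun h => hadj h.symm)
  refine ⟨P, Q, hP, hQ, ?_, ?_, ⟨hxP, hyP⟩, ⟨hxQ, hyQ⟩⟩
  · rw [Set.disjoint_left]
    intro z hz hz'
    exact hqr (hqt z (hPs z hz).1 (hPs z hz).2.1) (hrt z (hQs z hz').1 (hQs z hz').2.1)
  · rintro z (hz | hz)
    · exact ⟨hreach z (hsub₁ (hPs z hz).1), (hPs z hz).2⟩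
    · exact ⟨hreach z (hsub₂ (hQs z hz).1), (hQs z hz).2.2, (hQs z hz).2.1⟩

/-- The link of `v`: its neighbours, joined when they form a facial triangle with `v`. -/
def facialLink (G : SimpleGraph V) (v : V) : SimpleGraph V where
  Adj x y := G.IsFacialTriangle v x y
  symm := ⟨fun _ _ h => h.swap_right⟩
  loopless := ⟨fun _ h => h.2.2.1.ne rfl⟩

lemma facialLink_le (v : V) : G.facialLink v ≤ G := fun _ _ h => h.2.2.1

variable [Fintype V]

/-- The facial triangles on an edge that lies in a triangle are exactly two. -/
lemma IsPolyhedron.exists_facial_iff (hG : G.IsPolyhedron)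
    (h : ∀ ⦃u v w⦄, u ≠ v → G.Adj w u → G.Adj w v → ∃ w', w' ≠ w ∧ G.Adj w' u ∧ G.Adj w' v)
    {a b c : V} (hab : G.Adj a b) (hac : G.Adj a c) (hbc : G.Adj b c) :
    ∃ d f, d ≠ f ∧ ∀ x, G.IsFacialTriangle a b x ↔ x = d ∨ x = f := by
  obtain ⟨d, f, hdf, hd, hf⟩ := hG.exists_two_facial h hab hac hbc
  refine ⟨d, f, hdf, fun x => ⟨fun hx => ?_, ?_⟩⟩
  · by_contra! hcon
    exact hG.1.false_of_three_facial hd hf hx hdf hcon.1.symm hcon.2.symm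
  · rintro (rfl | rfl) <;> assumption

lemma IsPolyhedron.isCycles_facialLink (hG : G.IsPolyhedron)
    (h : ∀ ⦃u v w⦄, u ≠ v → G.Adj w u → G.Adj w v → ∃ w', w' ≠ w ∧ G.Adj w' u ∧ G.Adj w' v)
    (v : V) : (G.facialLink v).IsCycles := by
  rintro x ⟨y, hy⟩
  obtain ⟨d, f, hdf, hd⟩ := hG.exists_facial_iff h hy.1 hy.2.1 hy.2.2.1
  rw [Set.ncard_eq_two]
  refine ⟨d, f, hdf, ?_⟩
  ext z
  exact hd z

/-- If `v` lies in a facial triangle, then its link is a cycle through all its neighbours. -/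
lemma IsPolyhedron.reachable_facialLink (hG : G.IsPolyhedron)
    (h : ∀ ⦃u v w⦄, u ≠ v → G.Adj w u → G.Adj w v → ∃ w', w' ≠ w ∧ G.Adj w' u ∧ G.Adj w' v)
    {v c d u : V} (hcd : G.IsFacialTriangle v c d) (hu : G.Adj v u) :
    (G.facialLink v).Reachable c u := by
  by_contra hcu
  set R : Set V := {y | (G.facialLink v).Reachable c y} with hR
  set D := G.componentOff (insert v R) u with hD
  have hRv : ∀ x ∈ R, G.Adj v x := by
    intro x hx
    obtain ⟨p⟩ := (show (G.facialLink v).Reachable c x from hx).symm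
    cases p with
    | nil => exact hcd.1
    | cons hh _ => exact hh.1
  have hcyc := hG.isCycles_facialLink h v
  have huS : u ∉ insert v R := by
    rintro (rfl | hh)
    · exact hu.ne rfl
    · exact hcu hh
  have nD : ∀ x ∈ insert v R, x ∉ D := fun x hx hx' => notMem_of_mem_componentOff huS hx' hx
  have hDc : (G.induce D).Connected := connected_induce_componentOff
  have huD : u ∈ D := mem_componentOff_self
  -- a third vertex of the cycle
  have third : ∀ x y, ∃ z ∈ R, z ≠ x ∧ z ≠ y := by
    obtain ⟨e, f, hef, hef'⟩ := hG.exists_facial_iff h hcd.1 hcd.2.1 hcd.2.2.1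
    have he := (hef' e).2 (Or.inl rfl)
    have hf := (hef' f).2 (Or.inr rfl)
    have heR : e ∈ R := Adj.reachable (G := G.facialLink v) he
    have hfR : f ∈ R := Adj.reachable (G := G.facialLink v) hf
    have hcR : c ∈ R := Reachable.refl _
    have h₁ := he.2.2.1.ne
    have h₂ := hf.2.2.1.ne
    intro x y
    by_contra! hcon
    have k₁ := hcon c hcR
    have k₂ := hcon e heR
    have k₃ := hcon f hfR
    by_cases hcx : c = x
    · have := k₂ (by rintro rfl; exact h₁ hcx)
      have := k₃ (by rintro rfl; exact h₂ hcx)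
      exact hef (by simp_all)
    · have hcy := k₁ hcx
      by_cases hex : e = x
      · have := k₃ (by rintro rfl; exact hef hex)
        exact h₂ (by simp_all)
      · exact h₁ (by rw [hcy, k₂ hex])
  -- the component `D` has two attachments on the cycle
  have attach : ∀ x, ∃ y ∈ R, y ≠ x ∧ ∃ w ∈ D, G.Adj y w := by
    intro x
    by_contra! hcon
    obtain ⟨z, hzR, hzx, -⟩ := third x x
    by_cases hux : u = x
    · subst hux
      refine nD z (Or.inr hzR) (hG.2.mem_of_closed (a := v) (b := v) huD hu.ne' hu.ne'
        (hRv z hzR).ne' (hRv z hzR).ne' fun t ht w htw hwv _ => mem_componentOff_of_adj ht htw ?_)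
      rintro (hh | hh)
      · exact hwv hh
      · exact hcon w hh (fun hwu => hcu (hwu ▸ hh)) t ht htw.symm
    · refine nD z (Or.inr hzR) (hG.2.mem_of_closed (a := v) (b := x) huD hu.ne' hux
        (hRv z hzR).ne' hzx fun t ht w htw hwv hwx => mem_componentOff_of_adj ht htw ?_)
      rintro (hh | hh)
      · exact hwv hh
      · exact hcon w hh hwx t ht htw.symm
  obtain ⟨x, hxR, -, hxD⟩ := attach v
  obtain ⟨y, hyR, hyx, hyD⟩ := attach x
  have adj : ∀ x ∈ R, ∀ y ∈ R, y ≠ x → (∃ w ∈ D, G.Adj x w) → (∃ w ∈ D, G.Adj y w) →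
      (G.facialLink v).Adj x y := by
    intro x hxR y hyR hyx hxD hyD
    by_contra hxy
    obtain ⟨P, Q, hP, hQ, hPQ, hPQR, hPa, hQa⟩ := hcyc.exists_arcs hyx.symm hxy
      ((show (G.facialLink v).Reachable c x from hxR).symm.trans hyR)
    have hle := facialLink_le (G := G) v
    have hR' : ∀ z ∈ P ∪ Q, z ∈ R := fun z hz =>
      (show (G.facialLink v).Reachable c x from hxR).trans (hPQR z hz).1
    have hv : ∀ z ∈ P ∪ Q, G.Adj v z := fun z hz => hRv z (hR' z hz)
    refine hG.1.false_of_bipartite (c := v) (d := x) (f := y) (hRv x hxR).ne (hRv y hyR).ne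
      hyx.symm (hP.mono (comap_monotone _ hle)) (hQ.mono (comap_monotone _ hle)) hDc hPQ
      (Set.disjoint_left.2 fun z hz hz' => nD z (Or.inr (hR' z (Or.inl hz))) hz')
      (Set.disjoint_left.2 fun z hz hz' => nD z (Or.inr (hR' z (Or.inr hz))) hz')
      ⟨fun hz => (hv v (Or.inl hz)).ne rfl, fun hz => (hPQR x (Or.inl hz)).2.1 rfl,
        fun hz => (hPQR y (Or.inl hz)).2.2 rfl⟩
      ⟨fun hz => (hv v (Or.inr hz)).ne rfl, fun hz => (hPQR x (Or.inr hz)).2.1 rfl,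
        fun hz => (hPQR y (Or.inr hz)).2.2 rfl⟩
      ⟨nD v (Or.inl rfl), nD x (Or.inr hxR), nD y (Or.inr hyR)⟩ ?_ ?_ ⟨⟨u, huD, hu⟩, hxD, hyD⟩
    · obtain ⟨⟨z, hz, hxz⟩, ⟨t, ht, hyt⟩⟩ := hPa
      exact ⟨⟨z, hz, hv z (Or.inl hz)⟩, ⟨z, hz, hle hxz⟩, ⟨t, ht, hle hyt⟩⟩
    · obtain ⟨⟨z, hz, hxz⟩, ⟨t, ht, hyt⟩⟩ := hQa
      exact ⟨⟨z, hz, hv z (Or.inr hz)⟩, ⟨z, hz, hle hxz⟩, ⟨t, ht, hle hyt⟩⟩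
  have hxy := adj x hxR y hyR hyx hxD hyD
  by_cases hz : ∃ z ∈ R, z ≠ x ∧ z ≠ y ∧ ∃ w ∈ D, G.Adj z w
  · obtain ⟨z, hzR, hzx, hzy, hzD⟩ := hz
    have hxz := adj x hxR z hzR hzx hxD hzD
    have hyz := adj y hyR z hzR hzy hyD hzD
    refine hG.1.false_of_complete (C := {y}) (D := {z}) (F := D) hxy.1
      (connected_induce_singleton y) (connected_induce_singleton z) hDc ?_ ?_ ?_ ?_ ?_ ?_ ?_ ?_ ?_ ?_
    · simpa using hzy.symm
    · simpa using nD y (Or.inr hyR)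
    · simpa using nD z (Or.inr hzR)
    · simpa using ⟨(hRv y hyR).ne, (hRv z hzR).ne, nD v (Or.inl rfl)⟩
    · simpa using ⟨hyx.symm, hzx.symm, nD x (Or.inr hxR)⟩
    · simpa using ⟨hRv y hyR, hRv z hzR, u, huD, hu⟩
    · simpa using ⟨hxy.2.2.1, hxz.2.2.1, hxD⟩
    · simpa using hyz.2.2.1
    · simpa using hyD
    · simpa using hzD
  · push Not at hz
    obtain ⟨z, hzR, hzx, hzy⟩ := third x y
    have huT : u ∉ ({v, x, y} : Set V) := by
      have h₁ : u ≠ x := fun hh => hcu (hh ▸ hxR)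
      have h₂ : u ≠ y := fun hh => hcu (hh ▸ hyR)
      simp [hu.ne', h₁, h₂]
    have hzT : z ∉ ({v, x, y} : Set V) := by simp [(hRv z hzR).ne', hzx, hzy]
    refine nD z (Or.inr hzR) (componentOff_subset huD ?_ (hxy.2.2.2 u z huT hzT))
    intro t ht w htw hw
    simp only [Set.mem_insert_iff, Set.mem_singleton_iff, not_or] at hw
    refine mem_componentOff_of_adj ht htw ?_
    rintro (hh | hh)
    · exact hw.1 hh
    · exact hz w hh hw.2.1 hw.2.2 t ht htw.symm

end SimpleGraph

lemma Matrix.card_le_rank_add_one {m n K : Type*} [Field K] [Fintype m] [Fintype n]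
    (A : Matrix m n K) (h : ∀ v, A.mulVec v = 0 → ∀ i j, v i = v j) :
    Fintype.card n ≤ A.rank + 1 := by
  have h₁ := A.mulVecLin.finrank_range_add_finrank_ker
  rw [Module.finrank_fintype_fun_eq_card] at h₁
  have h₂ : LinearMap.ker A.mulVecLin ≤ Submodule.span K {(fun _ => 1 : n → K)} := by
    intro v hv
    rw [Submodule.mem_span_singleton]
    have hv' := h v (by simpa using hv)
    rcases isEmpty_or_nonempty n with hn | ⟨⟨i⟩⟩
    · exact ⟨0, Subsingleton.elim _ _⟩
    · exact ⟨v i, by ext j; simp [hv' i j]⟩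
  have h₃ := (Submodule.finrank_mono h₂).trans (finrank_span_le_card _)
  simp only [Set.toFinset_singleton, Finset.card_singleton] at h₃
  rw [Matrix.rank]
  omega

namespace SimpleGraph

variable {V : Type*} {G : SimpleGraph V}

lemma IsFacialTriangle.exists_eq [DecidableEq V] {x y z a b : V} (h : G.IsFacialTriangle x y z)
    (ha : a ∈ ({x, y, z} : Finset V)) (hb : b ∈ ({x, y, z} : Finset V)) (hab : a ≠ b) :
    ∃ w, ({x, y, z} : Finset V) = {a, b, w} ∧ G.IsFacialTriangle a b w := by
  simp only [Finset.mem_insert, Finset.mem_singleton] at ha hb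
  rcases ha with rfl | rfl | rfl <;> rcases hb with rfl | rfl | rfl
  · exact absurd rfl hab
  · exact ⟨_, rfl, h⟩
  · exact ⟨_, by rw [Finset.pair_comm], h.swap_right⟩
  · exact ⟨_, by rw [Finset.insert_comm], h.swap_left⟩
  · exact absurd rfl hab
  · exact ⟨_, by grind, h.swap_left.swap_right⟩
  · exact ⟨_, by grind, h.swap_right.swap_left⟩
  · exact ⟨_, by grind, h.swap_right.swap_left.swap_right⟩
  · exact absurd rfl hab

variable [Fintype V]

lemma IsKConnected.mem_of_adj_closed {k : ℕ} (hG : G.IsKConnected (k + 1)) {X : Set V} {x : V}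
    (hx : x ∈ X) (h : ∀ u ∈ X, ∀ w, G.Adj u w → w ∈ X) (y : V) : y ∈ X :=
  componentOff_subset hx (fun u hu w huw _ => h u hu w huw)
    (hG.mem_componentOff (S := ∅) (by simp) (by simp) (by simp))

/-- If some triangle exists, then every edge lies in a facial triangle. -/
lemma IsPolyhedron.exists_facial_of_adj (hG : G.IsPolyhedron)
    (h : ∀ ⦃u v w⦄, u ≠ v → G.Adj w u → G.Adj w v → ∃ w', w' ≠ w ∧ G.Adj w' u ∧ G.Adj w' v)
    {a b c : V} (hab : G.Adj a b) (hac : G.Adj a c) (hbc : G.Adj b c) {v w : V}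
    (hvw : G.Adj v w) : ∃ x, G.IsFacialTriangle v w x := by
  have step : ∀ v w, G.Adj v w → (∃ c d, G.IsFacialTriangle v c d) →
      ∃ x, G.IsFacialTriangle v w x := by
    rintro v w hvw ⟨c, d, hcd⟩
    obtain ⟨p⟩ := (hG.reachable_facialLink h hcd hvw).symm
    cases p with
    | nil => exact ⟨d, hcd⟩
    | cons hh _ => exact ⟨_, hh⟩
  refine step v w hvw (hG.2.mem_of_adj_closed (X := {v | ∃ c d, G.IsFacialTriangle v c d}) (x := a)
    ?_ ?_ v)
  · obtain ⟨d, -, -, hd, -⟩ := hG.exists_two_facial h hab hac hbc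
    exact ⟨b, d, hd⟩
  · intro u hu w huw
    obtain ⟨x, hx⟩ := step u w huw hu
    exact ⟨u, x, hx.swap_left⟩

/-- A function on facial triangles that agrees on triangles sharing an edge is constant. -/
lemma IsPolyhedron.facial_const (hG : G.IsPolyhedron)
    (h : ∀ ⦃u v w⦄, u ≠ v → G.Adj w u → G.Adj w v → ∃ w', w' ≠ w ∧ G.Adj w' u ∧ G.Adj w' v)
    [DecidableEq V] {α : Type*} (φ : Finset V → α)
    (hφ : ∀ a b x y, G.IsFacialTriangle a b x → G.IsFacialTriangle a b y →
      φ {a, b, x} = φ {a, b, y}) {a b c x y z : V} (habc : G.IsFacialTriangle a b c)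
    (hxyz : G.IsFacialTriangle x y z) : φ {a, b, c} = φ {x, y, z} := by
  -- all triangles at a common vertex have the same value
  have local_const : ∀ v c d c' d', G.IsFacialTriangle v c d → G.IsFacialTriangle v c' d' →
      φ {v, c, d} = φ {v, c', d'} := by
    intro v c d c' d' hcd hcd'
    obtain ⟨p⟩ := hG.reachable_facialLink h hcd hcd'.1
    induction p generalizing d with
    | nil => exact hφ _ _ _ _ hcd hcd'
    | @cons c e _ hce p ih =>
      rw [← ih c hce.swap_right hcd', hφ _ _ _ _ hcd hce, Finset.pair_comm]
  have key := hG.2.mem_of_adj_closed (k := 2)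
    (X := {v | ∀ p q, G.IsFacialTriangle v p q → φ {v, p, q} = φ {a, b, c}}) (x := a)
    (fun p q hpq => local_const _ _ _ _ _ hpq habc) ?_ x
  · exact (key y z hxyz).symm
  · intro u hu w huw p q hpq
    obtain ⟨t, ht⟩ := hG.exists_facial_of_adj h habc.1 habc.2.1 habc.2.2.1 huw
    rw [local_const _ _ _ _ _ hpq ht.swap_left, Finset.insert_comm]
    exact hu w t ht

/-- Euler's inequality for the facial triangles, in the form of a lower bound on the edges. -/
lemma IsPolyhedron.card_le_of_triangle (hG : G.IsPolyhedron)
    (h : ∀ ⦃u v w⦄, u ≠ v → G.Adj w u → G.Adj w v → ∃ w', w' ≠ w ∧ G.Adj w' u ∧ G.Adj w' v)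
    {a b c : V} (hab : G.Adj a b) (hac : G.Adj a c) (hbc : G.Adj b c) :
    3 * Fintype.card V ≤ G.edgeSet.ncard + 6 := by
  classical
  let T := {t : Finset V // ∃ x y z, t = {x, y, z} ∧ G.IsFacialTriangle x y z}
  let inc : T → G.edgeSet → Prop := fun t e => ∀ v ∈ e.1, v ∈ t.1
  have edges : ∀ {x y z : V} (hf : G.IsFacialTriangle x y z),
      Finset.univ.filter (inc ⟨{x, y, z}, x, y, z, rfl, hf⟩) =
        {⟨s(x, y), G.mem_edgeSet.2 hf.1⟩, ⟨s(x, z), G.mem_edgeSet.2 hf.2.1⟩,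
          ⟨s(y, z), G.mem_edgeSet.2 hf.2.2.1⟩} := by
    intro x y z hf
    ext ⟨e, he⟩
    induction e with
    | _ p q =>
      have hpq : p ≠ q := G.ne_of_adj he
      simp only [inc, Finset.mem_filter, Finset.mem_univ, true_and, Sym2.mem_iff,
        Finset.mem_insert, Finset.mem_singleton, Subtype.mk.injEq, Sym2.eq_iff,
        forall_eq_or_imp, forall_eq]
      grind
  have tris : ∀ {p q : V} (hpq : G.Adj p q), ∃ t₁ t₂ : T, t₁ ≠ t₂ ∧
      Finset.univ.filter (fun t => inc t ⟨s(p, q), G.mem_edgeSet.2 hpq⟩) = {t₁, t₂} := by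
    intro p q hpq
    obtain ⟨r, hr⟩ := hG.exists_facial_of_adj h hab hac hbc hpq
    obtain ⟨d, f, hdf, hiff⟩ := hG.exists_facial_iff h hpq hr.2.1 hr.2.2.1
    have hd := (hiff d).2 (Or.inl rfl)
    have hf := (hiff f).2 (Or.inr rfl)
    refine ⟨⟨{p, q, d}, p, q, d, rfl, hd⟩, ⟨{p, q, f}, p, q, f, rfl, hf⟩, ?_, ?_⟩
    · intro hh
      rw [Subtype.mk.injEq] at hh
      have : d ∈ ({p, q, f} : Finset V) := hh ▸ by simp
      simp only [Finset.mem_insert, Finset.mem_singleton] at this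
      rcases this with rfl | rfl | rfl
      · exact hd.2.1.ne rfl
      · exact hd.2.2.1.ne rfl
      · exact hdf rfl
    · ext ⟨t, x, y, z, rfl, ht⟩
      simp only [inc, Finset.mem_filter, Finset.mem_univ, true_and, Sym2.mem_iff,
        forall_eq_or_imp, forall_eq, Finset.mem_insert (a := (⟨_, _⟩ : T)),
        Finset.mem_singleton (a := (⟨_, _⟩ : T)), Subtype.mk.injEq]
      constructor
      · rintro ⟨hp, hq⟩
        obtain ⟨w, hw, hw'⟩ := ht.exists_eq hp hq hpq.ne
        rw [hw]
        rcases (hiff w).1 hw' with rfl | rfl <;> simp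
      · rintro (hh | hh) <;> rw [hh] <;> simp
  -- double counting of incidences
  have hcount : 3 * Fintype.card T = 2 * Fintype.card G.edgeSet := by
    have := Finset.sum_card_bipartiteAbove_eq_sum_card_bipartiteBelow (s := Finset.univ)
      (t := Finset.univ) inc
    rw [Finset.sum_congr rfl (g := fun _ => 3), Finset.sum_congr (s₁ := (Finset.univ : Finset
      G.edgeSet)) rfl (g := fun _ => 2)] at this
    · simpa [mul_comm] using this
    · rintro ⟨e, he⟩ -
      induction e with
      | _ p q =>
        obtain ⟨t₁, t₂, hne, ht⟩ := tris he
        rw [Finset.bipartiteBelow, ht, Finset.card_pair hne]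
    · rintro ⟨t, x, y, z, rfl, ht⟩ -
      have h₁ := ht.1.ne; have h₂ := ht.2.1.ne; have h₃ := ht.2.2.1.ne
      rw [Finset.bipartiteAbove, edges ht, Finset.card_eq_three]
      refine ⟨_, _, _, ?_, ?_, ?_, rfl⟩ <;> simp only [ne_eq, Subtype.mk.injEq, Sym2.eq_iff] <;>
        tauto
  obtain ⟨M, hMapp⟩ : ∃ M : Matrix T G.edgeSet (ZMod 2), ∀ t e, M t e = if inc t e then 1 else 0 :=
    ⟨Matrix.of _, fun _ _ => rfl⟩
  obtain ⟨N, hNapp⟩ : ∃ N : Matrix G.edgeSet V (ZMod 2), ∀ e v, N e v = if v ∈ e.1 then 1 else 0 :=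
    ⟨Matrix.of _, fun _ _ => rfl⟩
  have eq_of_add : ∀ s t : ZMod 2, s + t = 0 → s = t := by decide
  have hMN : M * N = 0 := by
    ext ⟨t, x, y, z, rfl, ht⟩ v
    have h₁ := ht.1.ne; have h₂ := ht.2.1.ne; have h₃ := ht.2.2.1.ne
    simp only [Matrix.mul_apply, hMapp, ite_mul, one_mul, zero_mul, Matrix.zero_apply]
    rw [← Finset.sum_filter, edges ht, Finset.sum_insert, Finset.sum_pair]
    · simp only [hNapp, Sym2.mem_iff]
      by_cases hx : v = x
      · subst hx
        simp only [h₁, h₂, or_false, or_self, if_true, if_false]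
        decide
      · by_cases hy : v = y
        · subst hy
          simp only [h₁.symm, h₃, or_false, or_true, or_self, if_true, if_false]
          decide
        · by_cases hz : v = z
          · subst hz
            simp only [h₂.symm, h₃.symm, or_true, or_self, if_true, if_false]
            decide
          · simp [hx, hy, hz]
    · simp only [ne_eq, Subtype.mk.injEq, Sym2.eq_iff]
      tauto
    · simp only [Finset.mem_insert, Finset.mem_singleton, Subtype.mk.injEq, Sym2.eq_iff]
      tauto
  have hN : Fintype.card V ≤ N.rank + 1 := by
    refine N.card_le_rank_add_one fun f hf i j => ?_
    have hadj : ∀ u w, G.Adj u w → f u = f w := by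
      intro u w huw
      have := congrFun hf ⟨s(u, w), G.mem_edgeSet.2 huw⟩
      simp only [Matrix.mulVec, dotProduct, hNapp, ite_mul, one_mul, zero_mul,
        Pi.zero_apply] at this
      rw [← Finset.sum_filter, show Finset.univ.filter (fun v => v ∈ s(u, w)) = {u, w} by ext; simp,
        Finset.sum_pair huw.ne] at this
      exact eq_of_add _ _ this
    exact (hG.2.mem_of_adj_closed (k := 2) (X := {v | f v = f i}) (x := i) rfl
      (fun u hu w huw => (hadj u w huw).symm.trans hu) j).symm
  have hM : Fintype.card T ≤ M.rank + 1 := by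
    rw [← M.rank_transpose]
    refine Matrix.card_le_rank_add_one _ fun f hf => ?_
    have hsum : ∀ p q (hpq : G.Adj p q) (s t : T), inc s ⟨s(p, q), G.mem_edgeSet.2 hpq⟩ →
        inc t ⟨s(p, q), G.mem_edgeSet.2 hpq⟩ → f s = f t := by
      intro p q hpq s t hs ht
      obtain ⟨t₁, t₂, hne, hfil⟩ := tris hpq
      have := congrFun hf ⟨s(p, q), G.mem_edgeSet.2 hpq⟩
      simp only [Matrix.mulVec, dotProduct, Matrix.transpose_apply, hMapp, ite_mul,
        one_mul, zero_mul, Pi.zero_apply] at this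
      rw [← Finset.sum_filter, hfil, Finset.sum_pair hne] at this
      have heq := eq_of_add _ _ this
      have hmem : ∀ r : T, inc r ⟨s(p, q), G.mem_edgeSet.2 hpq⟩ → r = t₁ ∨ r = t₂ := by
        intro r hr
        have : r ∈ Finset.univ.filter (fun t => inc t ⟨s(p, q), G.mem_edgeSet.2 hpq⟩) := by
          simpa using hr
        rw [hfil] at this
        simpa using this
      rcases hmem s hs with rfl | rfl <;> rcases hmem t ht with rfl | rfl <;> simp [heq]
    let φ : Finset V → ZMod 2 := fun t =>
      if ht : ∃ x y z, t = {x, y, z} ∧ G.IsFacialTriangle x y z then f ⟨t, ht⟩ else 0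
    have hφ : ∀ x y z (hf : G.IsFacialTriangle x y z), φ {x, y, z} = f ⟨_, x, y, z, rfl, hf⟩ :=
      fun x y z hf => dif_pos ⟨x, y, z, rfl, hf⟩
    rintro ⟨_, x, y, z, rfl, ht⟩ ⟨_, x', y', z', rfl, ht'⟩
    rw [← hφ x y z ht, ← hφ x' y' z' ht']
    refine hG.facial_const h φ ?_ ht ht'
    intro p q r s hr hs
    rw [hφ _ _ _ hr, hφ _ _ _ hs]
    exact hsum p q hr.1 _ _ (by simp [inc]) (by simp [inc])
  have hrank := Matrix.rank_add_rank_le_card_of_mul_eq_zero hMN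
  rw [Set.ncard_eq_toFinset_card', Set.toFinset_card]
  omega

end SimpleGraph

namespace SimpleGraph

lemma HasMinor.trans {V W U : Type*} {G : SimpleGraph V} {H : SimpleGraph W} {K : SimpleGraph U}
    (hGH : G.HasMinor H) (hHK : H.HasMinor K) : G.HasMinor K := by
  obtain ⟨f, hf, hfd, hfa⟩ := hGH
  obtain ⟨g, hg, hgd, hga⟩ := hHK
  have reach : ∀ s x (hx : x ∈ s), ∀ p (hp : p ∈ f x) q (hq : q ∈ f x),
      (G.induce (⋃ x ∈ s, f x)).Reachable ⟨p, Set.mem_biUnion hx hp⟩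
        ⟨q, Set.mem_biUnion hx hq⟩ := fun s x hx p hp q hq =>
    ((hf x).preconnected ⟨p, hp⟩ ⟨q, hq⟩).map
      (G.induceHomOfLE (Set.subset_biUnion_of_mem (u := f) hx)).toHom
  refine ⟨fun u => ⋃ x ∈ g u, f x, fun u => ?_, fun u v huv => ?_, fun u v huv => ?_⟩
  · obtain ⟨x, hx⟩ := (hg u).nonempty
    obtain ⟨p, hp⟩ := (hf x).nonempty
    rw [connected_iff_exists_forall_reachable]
    refine ⟨⟨p, Set.mem_biUnion hx hp⟩, ?_⟩
    rintro ⟨q, hq⟩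
    obtain ⟨y, hy, hqy⟩ := Set.mem_iUnion₂.1 hq
    obtain ⟨w⟩ := (hg u).preconnected ⟨x, hx⟩ ⟨y, hy⟩
    suffices ∀ a b : g u, (H.induce (g u)).Walk a b → ∀ p (hp : p ∈ f a) q (hq : q ∈ f b),
        (G.induce (⋃ x ∈ g u, f x)).Reachable ⟨p, Set.mem_biUnion a.2 hp⟩
          ⟨q, Set.mem_biUnion b.2 hq⟩ from this _ _ w p hp q hqy
    intro a b w
    induction w with
    | nil => exact reach _ _ (Subtype.prop _)
    | @cons a c b hac _ ih =>
      intro p hp q hq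
      obtain ⟨s, hs, t, ht, hst⟩ := hfa hac
      have : (G.induce (⋃ x ∈ g u, f x)).Adj ⟨s, Set.mem_biUnion a.2 hs⟩
        ⟨t, Set.mem_biUnion c.2 ht⟩ := hst
      exact (reach _ _ a.2 p hp s hs).trans (this.reachable.trans (ih t ht q hq))
  · simp only [Set.disjoint_iUnion_left, Set.disjoint_iUnion_right]
    intro x hx y hy
    exact hfd fun hxy => Set.disjoint_left.1 (hgd huv) hy (hxy ▸ hx)
  · obtain ⟨x, hx, y, hy, hxy⟩ := hga huv
    obtain ⟨p, hp, q, hq, hpq⟩ := hfa hxy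
    exact ⟨p, Set.mem_biUnion hx hp, q, Set.mem_biUnion hy hq, hpq⟩

lemma HasMinor.of_hom_injective {V W : Type*} {G : SimpleGraph V} {H : SimpleGraph W} (φ : H →g G)
    (hφ : Function.Injective φ) : G.HasMinor H :=
  ⟨fun w => {φ w}, fun w => connected_induce_singleton (φ w),
    fun _ _ h => by simpa using hφ.ne h, fun _ _ h => ⟨_, rfl, _, rfl, φ.map_adj h⟩⟩

variable {V : Type*} {G : SimpleGraph V}

lemma IsNClique.hasMinor {n : ℕ} {s : Finset V} (h : G.IsNClique n s) :
    G.HasMinor (completeGraph (Fin n)) := by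
  have φ := topEmbeddingOfNotCliqueFree (fun hf => hf s h : ¬ G.CliqueFree n)
  exact .of_hom_injective φ.toHom φ.injective

/-- The graph obtained by contracting the edge `uv` to the vertex `u`. -/
def contract (G : SimpleGraph V) (u v : V) : SimpleGraph ({v}ᶜ : Set V) :=
  (G ⊔ fromRel fun x y => x = u ∧ G.Adj v y).induce {v}ᶜ

lemma hasMinor_contract {u v : V} (huv : G.Adj u v) : G.HasMinor (G.contract u v) := by
  classical
  refine ⟨fun x => if x.1 = u then {u, v} else {x.1}, ?_, ?_, ?_⟩
  · intro x
    change (G.induce (if x.1 = u then {u, v} else {x.1})).Connected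
    by_cases h : x.1 = u
    · rw [if_pos h]
      exact connected_induce_insert_of_adj (connected_induce_singleton v) rfl huv
    · rw [if_neg h]
      exact connected_induce_singleton _
  · rintro ⟨x, hx⟩ ⟨y, hy⟩ hxy
    simp only [Set.mem_compl_iff, Set.mem_singleton_iff, ne_eq, Subtype.mk.injEq] at hx hy hxy
    dsimp only
    rw [Set.disjoint_left]
    split_ifs <;> simp only [Set.mem_insert_iff, Set.mem_singleton_iff] <;> grind
  · rintro ⟨x, hx⟩ ⟨y, hy⟩ hxy
    simp only [contract, comap_adj, Function.Embedding.subtype_apply, sup_adj, fromRel_adj] at hxy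
    dsimp only
    have mem : ∀ z, z ∈ (if z = u then {u, v} else {z} : Set V) := by
      intro z; split_ifs with h <;> simp [h]
    rcases hxy with hxy | ⟨-, ⟨rfl, hxy⟩ | ⟨rfl, hxy⟩⟩
    · exact ⟨x, mem x, y, mem y, hxy⟩
    · exact ⟨v, by simp, y, mem y, hxy⟩
    · exact ⟨x, mem x, v, by simp, hxy.symm⟩

variable [Fintype V]

open scoped Classical in
lemma card_edgeFinset_le_contract {u v : V} (huv : G.Adj u v) :
    G.edgeFinset.card ≤ (G.contract u v).edgeFinset.card + 1 +
      (G.neighborFinset u ∩ G.neighborFinset v).card := by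
  set K : SimpleGraph V := G ⊔ fromRel fun x y => x = u ∧ G.Adj v y with hK
  have h₁ : (G.contract u v).edgeFinset.card = K.edgeFinset.card - K.degree v := by
    have := (K.card_edgeFinset_induce_compl_singleton v).trans
      (K.card_edgeFinset_deleteIncidenceSet v)
    convert this
    rw [contract, hK]
  have h₂ : K.neighborFinset v = G.neighborFinset v := by
    ext w
    simp only [mem_neighborFinset, hK, sup_adj, fromRel_adj]
    have := huv.ne
    have := G.loopless
    grind [G.irrefl, G.adj_comm]
  let D := (G.neighborFinset v \ G.neighborFinset u).erase u
  have h₃ : Disjoint G.edgeFinset (D.image fun w => s(u, w)) := by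
    rw [Finset.disjoint_left]
    intro e he he'
    obtain ⟨w, hw, rfl⟩ := Finset.mem_image.1 he'
    simp only [D, Finset.mem_erase, Finset.mem_sdiff, mem_neighborFinset] at hw
    exact hw.2.2 (by simpa using he)
  have h₄ : G.edgeFinset ∪ (D.image fun w => s(u, w)) ⊆ K.edgeFinset := by
    intro e he
    rcases Finset.mem_union.1 he with he | he
    · exact edgeFinset_mono le_sup_left he
    · obtain ⟨w, hw, rfl⟩ := Finset.mem_image.1 he
      simp only [D, Finset.mem_erase, Finset.mem_sdiff, mem_neighborFinset] at hw
      simp [hK, hw.1.symm, hw.2.1]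
  have h₅ := Finset.card_le_card h₄
  rw [Finset.card_union_of_disjoint h₃, Finset.card_image_of_injective _
    fun a b => Sym2.congr_right.1, Finset.card_erase_of_mem (by simpa using huv.symm),
    Finset.card_sdiff] at h₅
  have h₆ : K.degree v = (G.neighborFinset v).card := by rw [← h₂, card_neighborFinset_eq_degree]
  have h₇ : (G.neighborFinset u ∩ G.neighborFinset v).card < (G.neighborFinset v).card := by
    refine Finset.card_lt_card ⟨Finset.inter_subset_right, fun hh => ?_⟩
    have := Finset.mem_inter.1 (hh ((G.mem_neighborFinset v u).2 huv.symm))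
    simp at this
  omega


lemma hasMinor_of_neighborFinset [DecidableEq V] [DecidableRel G.Adj] {x : V}
    (h₁ : 1 ≤ G.degree x) (h₅ : G.degree x ≤ 5)
    (h : ∀ y, G.Adj x y → 3 ≤ (G.neighborFinset x ∩ G.neighborFinset y).card) :
    G.HasMinor (completeGraph (Fin 5)) := by
  set N := G.neighborFinset x with hN
  have mem : ∀ {y}, y ∈ N ↔ G.Adj x y := G.mem_neighborFinset x _
  have hcard : N.card = G.degree x := G.card_neighborFinset_eq_degree x
  have hdiff : ∀ y ∈ N, (N \ G.neighborFinset y).card ≤ N.card - 3 := by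
    intro y hy
    have := h y (mem.1 hy)
    rw [Finset.card_sdiff, Finset.inter_comm]
    omega
  have h₄ : 4 ≤ N.card := by
    obtain ⟨y, hy⟩ := Finset.card_pos.1 (by omega : 0 < N.card)
    have h₀ : (N ∩ G.neighborFinset y).card < N.card := by
      refine Finset.card_lt_card ⟨Finset.inter_subset_left, fun hh => ?_⟩
      simpa using Finset.mem_inter.1 (hh hy)
    have := h y (mem.1 hy)
    omega
  by_cases hcl : G.IsClique N
  · obtain hc | hc : N.card = 4 ∨ N.card = 5 := by omega
    · exact (IsNClique.insert ⟨hcl, hc⟩ (a := x) fun b hb => mem.1 hb).hasMinor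
    · exact IsNClique.hasMinor ⟨hcl, hc⟩
  simp only [IsClique, Set.Pairwise, Finset.mem_coe, not_forall] at hcl
  obtain ⟨a, ha, b, hb, hab, hnab⟩ := hcl
  -- a vertex of `N` has at most one nonneighbour in `N`
  have two : ∀ y ∈ N, ∀ p ∈ N, ∀ q ∈ N, y ≠ p → y ≠ q → p ≠ q → ¬ G.Adj y p → G.Adj y q := by
    intro y hy p hp q hq hyp hyq hpq hnp
    by_contra hnq
    have := Finset.card_le_card (s := {y, p, q}) (t := N \ G.neighborFinset y) (by
      intro z hz
      simp only [Finset.mem_insert, Finset.mem_singleton] at hz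
      rcases hz with rfl | rfl | rfl <;>
        exact Finset.mem_sdiff.2 ⟨‹_›, by
          rw [mem_neighborFinset]; first | exact G.irrefl | assumption⟩)
    rw [Finset.card_eq_three.2 ⟨y, p, q, hyp, hyq, hpq, rfl⟩] at this
    have := hdiff y hy
    omega
  have hc5 : N.card = 5 := by
    have := Finset.card_le_card (s := {a, b}) (t := N \ G.neighborFinset a) (by
      intro z hz
      simp only [Finset.mem_insert, Finset.mem_singleton] at hz
      rcases hz with rfl | rfl <;> exact Finset.mem_sdiff.2 ⟨‹_›, by
          rw [mem_neighborFinset]; first | exact G.irrefl | assumption⟩)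
    rw [Finset.card_pair hab] at this
    have := hdiff a ha
    omega
  obtain ⟨c, d, f, hcd, hcf, hdf, hrest⟩ := Finset.card_eq_three.1 (by
    rw [Finset.card_erase_of_mem (Finset.mem_erase.2 ⟨hab.symm, hb⟩),
      Finset.card_erase_of_mem ha, hc5] : ((N.erase a).erase b).card = 3)
  have hmem : ∀ z, z ∈ N ∧ z ≠ a ∧ z ≠ b ↔ z = c ∨ z = d ∨ z = f := by
    intro z
    have : z ∈ (N.erase a).erase b ↔ z ∈ ({c, d, f} : Finset V) := by rw [hrest]
    simp only [Finset.mem_erase, Finset.mem_insert, Finset.mem_singleton] at this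
    tauto
  obtain ⟨hc, hca, hcb⟩ := (hmem c).2 (by simp)
  obtain ⟨hd, hda, hdb⟩ := (hmem d).2 (by simp)
  obtain ⟨hf, hfa, hfb⟩ := (hmem f).2 (by simp)
  have hba : ¬ G.Adj b a := fun hh => hnab hh.symm
  have key : ∀ c d f, c ∈ N → d ∈ N → f ∈ N → c ≠ a → c ≠ b → d ≠ a → d ≠ b → f ≠ a → f ≠ b →
      c ≠ f → d ≠ f → G.Adj c d → G.HasMinor (completeGraph (Fin 5)) := by
    intro c d f hc hd hf hca hcb hda hdb hfa hfb hcf hdf hcd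
    have ac := two a ha b hb c hc hab hca.symm hcb.symm hnab
    have ad := two a ha b hb d hd hab hda.symm hdb.symm hnab
    have af := two a ha b hb f hf hab hfa.symm hfb.symm hnab
    have bc := two b hb a ha c hc hab.symm hcb.symm hca.symm hba
    have bd := two b hb a ha d hd hab.symm hdb.symm hda.symm hba
    have bf := two b hb a ha f hf hab.symm hfb.symm hfa.symm hba
    rw [mem] at ha hb hc hd hf
    refine hasMinor_completeGraph ![{x}, {a, f}, {b}, {c}, {d}] ?_ ?_ ?_
    · intro i
      fin_cases i
      · exact connected_induce_singleton _
      · exact connected_induce_insert_of_adj (connected_induce_singleton f) rfl af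
      all_goals exact connected_induce_singleton _
    · have := ha.ne; have := hb.ne; have := hc.ne; have := hd.ne; have := hf.ne
      have := hcd.ne; have := hcf.symm; have := hdf.symm
      simp only [Fin.forall_fin_succ]
      simp_all [eq_comm]
    · simp only [Fin.forall_fin_succ]
      simp_all [bf.symm]
  by_cases hcd' : G.Adj c d
  · exact key c d f hc hd hf hca hcb hda hdb hfa hfb hcf hdf hcd'
  · exact key c f d hc hf hd hca hcb hfa hfb hda hdb hcd hdf.symm
      (two c hc d hd f hf hcd hcf hdf hcd')


/-- Mader's theorem for `K₅`. -/
theorem hasMinor_of_card_edgeFinset {V : Type*} [Fintype V] (G : SimpleGraph V)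
    [DecidableRel G.Adj] (h₃ : 3 ≤ Fintype.card V)
    (h : 3 * Fintype.card V ≤ G.edgeFinset.card + 5) : G.HasMinor (completeGraph (Fin 5)) := by
  classical
  induction hn : Fintype.card V using Nat.strong_induction_on generalizing V with
  | _ n ih =>
  subst hn
  -- pass to a spanning subgraph with exactly `3n - 5` edges
  obtain ⟨t, ht, htc⟩ := Finset.exists_subset_card_eq
    (by omega : 3 * Fintype.card V - 5 ≤ G.edgeFinset.card)
  obtain ⟨K, hKG, hK⟩ : ∃ K : SimpleGraph V, K ≤ G ∧
      K.edgeFinset.card = 3 * Fintype.card V - 5 := by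
    refine ⟨fromEdgeSet t, ?_, ?_⟩
    · rw [fromEdgeSet_le]
      exact Set.sdiff_subset.trans fun e he => mem_edgeFinset.1 (ht he)
    · rw [← htc]
      congr 1
      ext e
      refine (@mem_edgeFinset _ _ e (_)).trans ?_
      rw [edgeSet_fromEdgeSet, Set.mem_sdiff, Finset.mem_coe]
      exact and_iff_left_of_imp fun he => G.not_isDiag_of_mem_edgeFinset (ht he)
  refine HasMinor.trans (HasMinor.of_hom_injective (Hom.ofLE hKG) Function.injective_id) ?_
  have h₄ : 4 ≤ Fintype.card V := by
    by_contra hlt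
    have : Fintype.card V = 3 := by omega
    have h₅ := K.card_edgeFinset_le_card_choose_two
    rw [hK, this] at h₅
    revert h₅
    decide
  have hcard : ∀ v : V, Fintype.card ({v}ᶜ : Set V) + 1 = Fintype.card V := by
    intro v
    rw [Fintype.card_compl_set, Set.card_singleton]
    omega
  by_cases hcon : ∃ u v, K.Adj u v ∧ (K.neighborFinset u ∩ K.neighborFinset v).card ≤ 2
  · obtain ⟨u, v, huv, hle⟩ := hcon
    have h₅ := card_edgeFinset_le_contract huv
    have := hcard v
    exact (hasMinor_contract huv).trans (ih _ (by omega) _ (by omega) (by omega) rfl)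
  by_cases hiso : ∃ v, K.degree v = 0
  · obtain ⟨v, hv⟩ := hiso
    have h₅ := (K.card_edgeFinset_induce_compl_singleton v).trans
      (K.card_edgeFinset_deleteIncidenceSet v)
    have := hcard v
    exact (HasMinor.of_hom_injective (Embedding.induce {v}ᶜ).toHom
      Subtype.val_injective).trans (ih _ (by omega) _ (by omega) (by omega) rfl)
  push Not at hcon hiso
  obtain ⟨x, hx⟩ : ∃ x, K.degree x ≤ 5 := by
    by_contra! hdeg
    have h₅ := K.sum_degrees_eq_twice_card_edges
    have h₆ := Finset.card_nsmul_le_sum Finset.univ (fun v => K.degree v) 6 fun v _ => hdeg v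
    rw [Finset.card_univ, smul_eq_mul] at h₆
    omega
  exact hasMinor_of_neighborFinset (Nat.one_le_iff_ne_zero.2 (hiso x)) hx fun y hy => hcon x y hy

end SimpleGraph

namespace SimpleGraph

variable {V : Type*} {G : SimpleGraph V}

lemma IsKConnected.exists_adj_ne [Fintype V] (hG : G.IsKConnected 3) {v a b : V}
    (hva : v ≠ a) (hvb : v ≠ b) :
    ∃ w, G.Adj v w ∧ w ≠ a ∧ w ≠ b := by
  classical
  by_contra! hcon
  have huniv : (Finset.univ : Finset V) ⊆ {v, a, b} := by
    intro y _
    by_contra hy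
    simp only [Finset.mem_insert, Finset.mem_singleton, not_or] at hy
    exact hy.1 (hG.mem_of_closed (X := {v}) rfl hva hvb hy.2.1 hy.2.2
      fun u hu w huw hwa hwb => absurd (hcon w (hu ▸ huw) hwa) hwb)
  have := (Finset.card_le_card huniv).trans Finset.card_le_three
  have := hG.1
  rw [Finset.card_univ] at *
  omega

section TriangleFree

lemma IsPlanar.adj_of_three_commonNeighbors (hG : G.IsPlanar)
    (h : ∀ ⦃u v w⦄, u ≠ v → G.Adj w u → G.Adj w v → ∃ w', w' ≠ w ∧ G.Adj w' u ∧ G.Adj w' v)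
    (ht : ∀ ⦃a b c⦄, G.Adj a b → G.Adj b c → ¬ G.Adj a c) {a x n₁ n₂ n₃ : V} (hax : a ≠ x)
    (h₁₂ : n₁ ≠ n₂) (h₁₃ : n₁ ≠ n₃) (h₂₃ : n₂ ≠ n₃)
    (a₁ : G.Adj a n₁) (a₂ : G.Adj a n₂) (a₃ : G.Adj a n₃)
    (x₁ : G.Adj x n₁) (x₂ : G.Adj x n₂) (x₃ : G.Adj x n₃) {n : V} (an : G.Adj a n) :
    G.Adj x n := by
  by_contra hxn
  have hn₁ : n₁ ≠ n := by rintro rfl; exact hxn x₁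
  have hn₂ : n₂ ≠ n := by rintro rfl; exact hxn x₂
  have hn₃ : n₃ ≠ n := by rintro rfl; exact hxn x₃
  obtain ⟨y₁, hy₁, y₁n₁, y₁n⟩ := h hn₁ a₁ an
  obtain ⟨y₂, hy₂, y₂n₂, y₂n⟩ := h hn₂ a₂ an
  obtain ⟨y₃, hy₃, y₃n₃, y₃n⟩ := h hn₃ a₃ an
  have hxn' : x ≠ n := by rintro rfl; exact ht an x₁ a₁
  have hxy : ∀ y, G.Adj y n → x ≠ y := by rintro y hy rfl; exact hxn hy
  have hny : ∀ m y, G.Adj a m → G.Adj y n → m ≠ y := by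
    rintro m y hm hy rfl; exact ht hm hy an
  refine hG.false_of_bipartite_set (Z := insert y₁ (insert y₂ (insert y₃ {n}))) hax h₁₂ h₁₃ h₂₃
    a₁ a₂ a₃ x₁ x₂ x₃ ?_ ?_ ?_ ?_ ?_ ?_ ⟨y₁, by simp, y₁n₁.symm⟩ ⟨y₂, by simp, y₂n₂.symm⟩
    ⟨y₃, by simp, y₃n₃.symm⟩
  · exact connected_induce_insert_of_adj (connected_induce_insert_of_adj
      (connected_induce_insert_of_adj (connected_induce_singleton n) rfl y₃n)
      (by simp) y₂n) (by simp) y₁n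
  · simp [hy₁.symm, hy₂.symm, hy₃.symm, an.ne]
  · simp [hxy _ y₁n, hxy _ y₂n, hxy _ y₃n, hxn']
  · simp [hny _ _ a₁ y₁n, hny _ _ a₁ y₂n, hny _ _ a₁ y₃n, hn₁]
  · simp [hny _ _ a₂ y₁n, hny _ _ a₂ y₂n, hny _ _ a₂ y₃n, hn₂]
  · simp [hny _ _ a₃ y₁n, hny _ _ a₃ y₂n, hny _ _ a₃ y₃n, hn₃]

variable [Fintype V]

lemma IsPolyhedron.false_of_three_commonNeighbors (hG : G.IsPolyhedron)
    (h : ∀ ⦃u v w⦄, u ≠ v → G.Adj w u → G.Adj w v → ∃ w', w' ≠ w ∧ G.Adj w' u ∧ G.Adj w' v)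
    (ht : ∀ ⦃a b c⦄, G.Adj a b → G.Adj b c → ¬ G.Adj a c) {a x n₁ n₂ n₃ : V} (hax : a ≠ x)
    (h₁₂ : n₁ ≠ n₂) (h₁₃ : n₁ ≠ n₃) (h₂₃ : n₂ ≠ n₃)
    (a₁ : G.Adj a n₁) (a₂ : G.Adj a n₂) (a₃ : G.Adj a n₃)
    (x₁ : G.Adj x n₁) (x₂ : G.Adj x n₂) (x₃ : G.Adj x n₃) : False := by
  have hN : ∀ n, G.Adj a n → G.Adj x n := fun n =>
    hG.1.adj_of_three_commonNeighbors h ht hax h₁₂ h₁₃ h₂₃ a₁ a₂ a₃ x₁ x₂ x₃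
  obtain ⟨y, hn₁y, hya, hyx⟩ := hG.2.exists_adj_ne a₁.ne' x₁.ne'
  set S : Set V := insert a (insert x {n | G.Adj a n}) with hS
  have hyS : y ∉ S := by
    simp only [hS, Set.mem_insert_iff, Set.mem_ofPred_eq, not_or]
    exact ⟨hya, hyx, ht a₁ hn₁y⟩
  set Y := G.componentOff S y
  have hYS : ∀ u ∈ Y, u ≠ a ∧ u ≠ x ∧ ¬ G.Adj a u := fun u hu => by
    have := notMem_of_mem_componentOff hyS hu
    simpa only [hS, Set.mem_insert_iff, Set.mem_ofPred_eq, not_or] using this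
  have hYc : ∀ u ∈ Y, ∀ w, G.Adj u w → w = x ∨ G.Adj a w ∨ w ∈ Y := by
    intro u hu w huw
    by_contra! hw
    refine hw.2.2 (mem_componentOff_of_adj hu huw ?_)
    simp only [hS, Set.mem_insert_iff, Set.mem_ofPred_eq, not_or]
    refine ⟨?_, hw.1, hw.2.1⟩
    rintro rfl
    exact (hYS u hu).2.2 huw.symm
  -- at most two neighbours of `a` have neighbours in `Y`
  have htwo : ∀ p q r, G.Adj a p → G.Adj a q → G.Adj a r → p ≠ q → p ≠ r → q ≠ r →
      (∃ z ∈ Y, G.Adj p z) → (∃ z ∈ Y, G.Adj q z) → ¬ ∃ z ∈ Y, G.Adj r z := by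
    intro p q r hp hq hr hpq hpr hqr zp zq zr
    exact hG.1.false_of_bipartite_set hax hpq hpr hqr hp hq hr (hN p hp) (hN q hq) (hN r hr)
      connected_induce_componentOff (fun hh => (hYS a hh).1 rfl) (fun hh => (hYS x hh).2.1 rfl)
      (fun hh => (hYS p hh).2.2 hp) (fun hh => (hYS q hh).2.2 hq) (fun hh => (hYS r hh).2.2 hr)
      zp zq zr
  obtain ⟨m, am, hm⟩ : ∃ m, G.Adj a m ∧ ∀ p, G.Adj a p → (∃ z ∈ Y, G.Adj p z) → p = n₁ ∨ p = m := by
    by_cases hcon : ∃ m, G.Adj a m ∧ m ≠ n₁ ∧ ∃ z ∈ Y, G.Adj m z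
    · obtain ⟨m, am, hm, hz⟩ := hcon
      refine ⟨m, am, fun p ap hp => ?_⟩
      by_contra! hpm
      exact htwo n₁ m p a₁ am ap hm.symm hpm.1.symm hpm.2.symm ⟨y, mem_componentOff_self, hn₁y⟩
        hz hp
    · push Not at hcon
      refine ⟨n₁, a₁, fun p ap ⟨z, hz, hpz⟩ => ?_⟩
      by_contra! hp
      exact hcon p ap hp.1 z hz hpz
  by_cases hq : ∃ q ∈ Y, G.Adj x q
  · obtain ⟨q, hqY, hxq⟩ := hq
    obtain ⟨n, an, hn₁, hnm⟩ : ∃ n, G.Adj a n ∧ n ≠ n₁ ∧ n ≠ m := by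
      by_cases h₂ : n₂ = m
      · exact ⟨n₃, a₃, h₁₃.symm, h₂ ▸ h₂₃.symm⟩
      · exact ⟨n₂, a₂, h₁₂.symm, h₂⟩
    have hnY : ∀ z ∈ Y, ¬ G.Adj n z := by
      intro z hz hnz
      rcases hm n an ⟨z, hz, hnz⟩ with hh | hh
      · exact hn₁ hh
      · exact hnm hh
    have hqn : q ≠ n := by rintro rfl; exact (hYS q hqY).2.2 an
    obtain ⟨r, hrx, hrq, hrn⟩ := h hqn hxq (hN n an)
    rcases hYc q hqY r hrq.symm with rfl | hr | hr
    · exact hrx rfl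
    · exact ht hr hrn an
    · exact hnY r hr hrn.symm
  · push Not at hq
    have := hG.2.mem_of_closed (X := Y) (a := n₁) (b := m) (x := y) (y := a) mem_componentOff_self
      hn₁y.ne' (by rintro rfl; exact ht a₁ hn₁y am) a₁.ne am.ne ?_
    · exact (hYS a this).1 rfl
    · intro u hu w huw hw₁ hwm
      rcases hYc u hu w huw with rfl | hw | hw
      · exact absurd huw.symm (hq u hu)
      · rcases hm w hw ⟨u, hu, huw.symm⟩ with hh | hh
        · exact absurd hh hw₁
        · exact absurd hh hwm
      · exact hw

lemma IsPolyhedron.eq_of_adj_of_triangleFree (hG : G.IsPolyhedron)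
    (h : ∀ ⦃u v w⦄, u ≠ v → G.Adj w u → G.Adj w v → ∃ w', w' ≠ w ∧ G.Adj w' u ∧ G.Adj w' v)
    (ht : ∀ ⦃a b c⦄, G.Adj a b → G.Adj b c → ¬ G.Adj a c) {a n₁ n₂ n₃ n₄ : V}
    (h₁₂ : n₁ ≠ n₂) (h₁₃ : n₁ ≠ n₃) (h₂₃ : n₂ ≠ n₃)
    (a₁ : G.Adj a n₁) (a₂ : G.Adj a n₂) (a₃ : G.Adj a n₃) (a₄ : G.Adj a n₄) :
    n₄ = n₁ ∨ n₄ = n₂ ∨ n₄ = n₃ := by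
  by_contra! hne
  obtain ⟨h₁₄, h₂₄, h₃₄⟩ := hne
  have three : ∀ x p q r, x ≠ a → p ≠ q → p ≠ r → q ≠ r → G.Adj a p → G.Adj a q → G.Adj a r →
      G.Adj x p → G.Adj x q → ¬ G.Adj x r := fun x p q r hx hpq hpr hqr ap aq ar xp xq xr =>
    hG.false_of_three_commonNeighbors h ht hx.symm hpq hpr hqr ap aq ar xp xq xr
  have far : ∀ x p q, G.Adj x p → G.Adj a p → G.Adj a q → x ≠ q := by
    rintro x p q xp ap aq rfl
    exact ht aq xp ap
  obtain ⟨x, hx, x₁, x₂⟩ := h h₁₂ a₁ a₂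
  obtain ⟨y, hy, y₁, y₃⟩ := h h₁₃ a₁ a₃
  obtain ⟨z, hz, z₁, z₄⟩ := h h₁₄.symm a₁ a₄
  obtain ⟨u, hu, u₂, u₃⟩ := h h₂₃ a₂ a₃
  obtain ⟨v, hv, v₂, v₄⟩ := h h₂₄.symm a₂ a₄
  obtain ⟨w, hw, w₃, w₄⟩ := h h₃₄.symm a₃ a₄
  refine hG.1.false_of_complete (a := a) (b := n₄) (C := insert x (insert y (insert z {n₁})))
    (D := insert u (insert v {n₂})) (F := insert w {n₃}) a₄ ?_ ?_ ?_ ?_ ?_ ?_ ?_ ?_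
    ⟨⟨n₁, by simp, a₁⟩, ⟨n₂, by simp, a₂⟩, ⟨n₃, by simp, a₃⟩⟩
    ⟨⟨z, by simp, z₄.symm⟩, ⟨v, by simp, v₄.symm⟩, ⟨w, by simp, w₄.symm⟩⟩
    ⟨x, by simp, n₂, by simp, x₂⟩ ⟨y, by simp, n₃, by simp, y₃⟩ ⟨u, by simp, n₃, by simp, u₃⟩
  · exact connected_induce_insert_of_adj (connected_induce_insert_of_adj
      (connected_induce_insert_of_adj (connected_induce_singleton n₁) rfl z₁)
      (by simp) y₁) (by simp) x₁
  · exact connected_induce_insert_of_adj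
      (connected_induce_insert_of_adj (connected_induce_singleton n₂) rfl v₂) (by simp) u₂
  · exact connected_induce_insert_of_adj (connected_induce_singleton n₃) rfl w₃
  · simp only [Set.disjoint_left, Set.mem_insert_iff, Set.mem_singleton_iff]
    grind
  · simp only [Set.disjoint_left, Set.mem_insert_iff, Set.mem_singleton_iff]
    grind
  · simp only [Set.disjoint_left, Set.mem_insert_iff, Set.mem_singleton_iff]
    grind
  · have := a₁.ne; have := a₂.ne; have := a₃.ne
    simp only [Set.mem_insert_iff, Set.mem_singleton_iff]
    grind
  · simp only [Set.mem_insert_iff, Set.mem_singleton_iff]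
    grind

end TriangleFree

end SimpleGraph

namespace SimpleGraph

variable {V : Type*} {G : SimpleGraph V} [Fintype V]

lemma IsPolyhedron.nonempty_iso_cubeGraph (hG : G.IsPolyhedron)
    (h : ∀ ⦃u v w⦄, u ≠ v → G.Adj w u → G.Adj w v → ∃ w', w' ≠ w ∧ G.Adj w' u ∧ G.Adj w' v)
    (ht : ∀ ⦃a b c⦄, G.Adj a b → G.Adj b c → ¬ G.Adj a c) : Nonempty (G ≃g cubeGraph) := by
  have nbrs : ∀ {v p q r}, G.Adj v p → G.Adj v q → G.Adj v r → p ≠ q → p ≠ r → q ≠ r →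
      ∀ w, G.Adj v w ↔ w = p ∨ w = q ∨ w = r := by
    intro v p q r vp vq vr hpq hpr hqr w
    refine ⟨hG.eq_of_adj_of_triangleFree h ht hpq hpr hqr vp vq vr, ?_⟩
    rintro (rfl | rfl | rfl) <;> assumption
  have three : ∀ {x a p q r}, x ≠ a → p ≠ q → p ≠ r → q ≠ r → G.Adj a p → G.Adj a q → G.Adj a r →
      G.Adj x p → G.Adj x q → ¬ G.Adj x r := fun hx hpq hpr hqr ap aq ar xp xq xr =>
    hG.false_of_three_commonNeighbors h ht hx.symm hpq hpr hqr ap aq ar xp xq xr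
  have hcard := hG.2.1
  obtain ⟨a⟩ : Nonempty V := Fintype.card_pos_iff.1 (by omega)
  obtain ⟨b, hb⟩ := Fintype.exists_ne_of_one_lt_card (by omega) a
  obtain ⟨n₁, a₁, -⟩ := hG.2.exists_adj_ne hb.symm hb.symm
  obtain ⟨n₂, a₂, h₂₁, -⟩ := hG.2.exists_adj_ne a₁.ne a₁.ne
  obtain ⟨n₃, a₃, h₃₁, h₃₂⟩ := hG.2.exists_adj_ne a₁.ne a₂.ne
  have Na := nbrs a₁ a₂ a₃ h₂₁.symm h₃₁.symm h₃₂.symm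
  obtain ⟨x, hxa, x₁, x₂⟩ := h h₂₁.symm a₁ a₂
  obtain ⟨y, hya, y₁, y₃⟩ := h h₃₁.symm a₁ a₃
  obtain ⟨z, hza, z₂, z₃⟩ := h h₃₂.symm a₂ a₃
  have x₃ : ¬ G.Adj x n₃ := three hxa h₂₁.symm h₃₁.symm h₃₂.symm a₁ a₂ a₃ x₁ x₂
  have y₂ : ¬ G.Adj y n₂ := three hya h₃₁.symm h₂₁.symm h₃₂ a₁ a₃ a₂ y₁ y₃
  have z₁ : ¬ G.Adj z n₁ := three hza h₃₂.symm h₂₁ h₃₁ a₂ a₃ a₁ z₂ z₃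
  have hxy : x ≠ y := by rintro rfl; exact x₃ y₃
  have hxz : x ≠ z := by rintro rfl; exact x₃ z₃
  have hyz : y ≠ z := by rintro rfl; exact y₂ z₂
  have N₁ := nbrs a₁.symm x₁.symm y₁.symm hxa.symm hya.symm hxy
  have N₂ := nbrs a₂.symm x₂.symm z₂.symm hxa.symm hza.symm hxz
  have N₃ := nbrs a₃.symm y₃.symm z₃.symm hya.symm hza.symm hyz
  obtain ⟨c, xc, hc₁, hc₂⟩ := hG.2.exists_adj_ne x₁.ne x₂.ne
  have hc₃ : c ≠ n₃ := by rintro rfl; exact x₃ xc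
  have hca : ¬ G.Adj c a := fun hca => by
    rcases (Na c).1 hca.symm with hh | hh | hh
    · exact hc₁ hh
    · exact hc₂ hh
    · exact hc₃ hh
  have cy : G.Adj c y := by
    obtain ⟨r, hrx, hrc, hr⟩ := h hc₁ xc x₁
    rcases (N₁ r).1 hr.symm with rfl | rfl | rfl
    · exact absurd hrc.symm hca
    · exact absurd rfl hrx
    · exact hrc.symm
  have cz : G.Adj c z := by
    obtain ⟨r, hrx, hrc, hr⟩ := h hc₂ xc x₂
    rcases (N₂ r).1 hr.symm with rfl | rfl | rfl
    · exact absurd hrc.symm hca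
    · exact absurd rfl hrx
    · exact hrc.symm
  have Nx := nbrs x₁ x₂ xc h₂₁.symm hc₁.symm hc₂.symm
  have Ny := nbrs y₁ y₃ cy.symm h₃₁.symm hc₁.symm hc₃.symm
  have Nz := nbrs z₂ z₃ cz.symm h₃₂.symm hc₂.symm hc₃.symm
  have Nc := nbrs xc.symm cy cz hxy hxz hyz
  have huniv : ∀ v, v = a ∨ v = n₁ ∨ v = n₂ ∨ v = n₃ ∨ v = x ∨ v = y ∨ v = z ∨ v = c := by
    refine hG.2.mem_of_adj_closed (k := 2) (x := a)
      (X := {v | v = a ∨ v = n₁ ∨ v = n₂ ∨ v = n₃ ∨ v = x ∨ v = y ∨ v = z ∨ v = c})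
      (Or.inl rfl) ?_
    intro u hu w huw
    rcases hu with rfl | rfl | rfl | rfl | rfl | rfl | rfl | rfl
    all_goals simp only [Na, N₁, N₂, N₃, Nx, Ny, Nz, Nc] at huw
    all_goals rcases huw with rfl | rfl | rfl <;> simp
  have hnodup : [a, n₁, n₂, n₃, x, y, z, c].Nodup := by
    have := a₁.ne; have := a₂.ne; have := a₃.ne; have := x₁.ne; have := x₂.ne; have := y₁.ne
    have := y₃.ne; have := z₂.ne; have := z₃.ne; have := xc.ne; have := cy.ne; have := cz.ne
    have e₁ : n₁ ≠ z := by rintro rfl; exact ht z₂ a₂.symm a₁.symm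
    have e₂ : n₂ ≠ y := by rintro rfl; exact ht y₁ a₁.symm a₂.symm
    have e₃ : n₃ ≠ x := by rintro rfl; exact ht x₁ a₁.symm a₃.symm
    have e₄ : a ≠ c := by rintro rfl; exact ht xc a₁ x₁
    simp only [List.nodup_cons, List.mem_cons, List.not_mem_nil, List.nodup_nil]
    grind
  let f : (Fin 2 × Fin 2) × Fin 2 → V := fun p =>
    (![![![a, n₃], ![n₂, z]], ![![n₁, y], ![x, c]]] : Fin 2 → Fin 2 → Fin 2 → V) p.1.1 p.1.2 p.2
  simp only [List.nodup_cons, List.mem_cons, List.not_mem_nil, List.nodup_nil, or_false,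
    not_or, not_false_eq_true, and_true] at hnodup
  obtain ⟨⟨d₁, d₂, d₃, d₄, d₅, d₆, d₇⟩, ⟨d₈, d₉, d₁₀, d₁₁, d₁₂, d₁₃⟩, ⟨d₁₄, d₁₅, d₁₆, d₁₇, d₁₈⟩,
    ⟨d₁₉, d₂₀, d₂₁, d₂₂⟩, ⟨d₂₃, d₂₄, d₂₅⟩, ⟨d₂₆, d₂₇⟩, d₂₈⟩ := hnodup
  have hadj : ∀ p q, G.Adj (f p) (f q) ↔ cubeGraph.Adj p q := by
    simp only [Prod.forall, Fin.forall_fin_two, f, cubeGraph, boxProd_adj]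
    simp [*, Ne.symm]
  have hinj : Function.Injective f := by
    intro p q hpq
    have key : ∀ p q, (∀ r, cubeGraph.Adj p r ↔ cubeGraph.Adj q r) → p = q := by
      simp only [cubeGraph, boxProd_adj, completeGraph_eq_top, top_adj]
      decide
    exact key p q fun r => by rw [← hadj, ← hadj, hpq]
  have hsurj : Function.Surjective f := by
    intro v
    rcases huniv v with rfl | rfl | rfl | rfl | rfl | rfl | rfl | rfl
    exacts [⟨((0, 0), 0), rfl⟩, ⟨((1, 0), 0), rfl⟩, ⟨((0, 1), 0), rfl⟩, ⟨((0, 0), 1), rfl⟩,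
      ⟨((1, 1), 0), rfl⟩, ⟨((1, 0), 1), rfl⟩, ⟨((0, 1), 1), rfl⟩, ⟨((1, 1), 1), rfl⟩]
  exact ⟨(⟨Equiv.ofBijective f ⟨hinj, hsurj⟩, hadj _ _⟩ : cubeGraph ≃g G).symm⟩

end SimpleGraph

/-- If `G` is a polyhedron with `1 ∉ A(G)`, then `G` is
isomorphic to the graph of the cube, or `G` is maximal planar, i.e. has
exactly `3p - 6` edges where `p` is the number of vertices. -/
theorem stmt0 {V : Type*} [Fintype V] (G : SimpleGraph V)
    (hG : G.IsPolyhedron) (h1 : 1 ∉ G.commA) :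
    Nonempty (G ≃g cubeGraph) ∨ G.edgeSet.ncard = 3 * Fintype.card V - 6 := by
  have h : ∀ ⦃u v w⦄, u ≠ v → G.Adj w u → G.Adj w v →
      ∃ w', w' ≠ w ∧ G.Adj w' u ∧ G.Adj w' v := by
    intro u v w huv hu hv
    by_contra! hcon
    refine h1 ⟨u, v, huv, Set.ncard_eq_one.2 ⟨w, Set.eq_singleton_iff_unique_mem.2
      ⟨G.mem_commonNeighbors.2 ⟨hu.symm, hv.symm⟩, fun w' hw' => ?_⟩⟩⟩
    by_contra hne
    obtain ⟨hu', hv'⟩ := G.mem_commonNeighbors.1 hw'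
    exact hcon w' hne hu'.symm hv'.symm
  by_cases ht : ∃ a b c, G.Adj a b ∧ G.Adj b c ∧ G.Adj a c
  · right
    classical
    obtain ⟨a, b, c, hab, hbc, hac⟩ := ht
    have hlower := hG.card_le_of_triangle h hab hac hbc
    have hupper : ¬ 3 * Fintype.card V ≤ G.edgeFinset.card + 5 := fun hle =>
      hG.1.1 (hasMinor_of_card_edgeFinset G (by have := hG.2.1; omega) hle)
    rw [← coe_edgeFinset, Set.ncard_coe_finset] at hlower ⊢
    omega
  · push Not at ht
    exact Or.inl (hG.nonempty_iso_cubeGraph h ht)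
end

section
/- Let G be a finite planar simple graph. Then 2 ∈ A(G) if and only if G contains a cycle of length 4. -/
open SimpleGraph

/-- `G` contains a cycle of length `n`. -/
def SimpleGraph.HasNCycle {V : Type*} (G : SimpleGraph V) (n : ℕ) : Prop :=
  ∃ (v : V) (c : G.Walk v v), c.IsCycle ∧ c.length = n

theorem SimpleGraph.HasMinor.mono {V W : Type*} {G G' : SimpleGraph V} {H : SimpleGraph W}
    (h : G ≤ G') (hm : G.HasMinor H) : G'.HasMinor H := by
  obtain ⟨f, hc, hd, ha⟩ := hm
  refine ⟨f, fun w => (hc w).mono fun x y hxy => h hxy, hd, fun w₁ w₂ hw => ?_⟩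
  obtain ⟨x, hx, y, hy, hxy⟩ := ha hw
  exact ⟨x, hx, y, hy, h hxy⟩

theorem SimpleGraph.connected_induce_singleton_s3 {V : Type*} (G : SimpleGraph V) (x : V) :
    (G.induce {x}).Connected := by
  have : Subsingleton ({x} : Set V) := by infer_instance
  exact { preconnected := .of_subsingleton, nonempty := ⟨⟨x, rfl⟩⟩ }

theorem SimpleGraph.Connected.induce_insert {V : Type*} {G : SimpleGraph V} {x y : V} {X : Set V}
    (hX : (G.induce X).Connected) (hy : y ∈ X) (hxy : G.Adj x y) :
    (G.induce (insert x X)).Connected := by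
  rw [← Set.singleton_union]
  exact connected_induce_union (G.connected_induce_singleton_s3 x).preconnected hX.preconnected
    (Set.mem_singleton x) hy hxy

theorem SimpleGraph.hasMinor_K33 {V : Type*} {G : SimpleGraph V} {v w a b c : V} {X : Set V}
    (hX : (G.induce X).Connected) (hvw : v ≠ w) (hab : a ≠ b) (hac : a ≠ c) (hbc : b ≠ c)
    (hvX : v ∉ X) (hwX : w ∉ X) (haX : a ∉ X) (hbX : b ∉ X) (hcX : c ∉ X)
    (hva : G.Adj v a) (hvb : G.Adj v b) (hvc : G.Adj v c)
    (hwa : G.Adj w a) (hwb : G.Adj w b) (hwc : G.Adj w c)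
    (hXa : ∃ x ∈ X, G.Adj x a) (hXb : ∃ x ∈ X, G.Adj x b) (hXc : ∃ x ∈ X, G.Adj x c) :
    G.HasMinor (completeBipartiteGraph (Fin 3) (Fin 3)) := by
  refine ⟨Sum.elim ![{v}, {w}, X] ![{a}, {b}, {c}], ?_, ?_, ?_⟩
  · rintro (i | i) <;> fin_cases i <;> simp only [Sum.elim_inl, Sum.elim_inr] <;>
      first | exact G.connected_induce_singleton_s3 _ | exact hX
  · have := hva.ne; have := hvb.ne; have := hvc.ne
    have := hwa.ne; have := hwb.ne; have := hwc.ne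
    rintro (i | i) (j | j) hij <;> fin_cases i <;> fin_cases j <;> simp_all [eq_comm]
  · have key : ∀ i j : Fin 3, ∃ x ∈ (![{v}, {w}, X] : Fin 3 → Set V) i,
        ∃ y ∈ (![{a}, {b}, {c}] : Fin 3 → Set V) j, G.Adj x y := by
      intro i j
      fin_cases i <;> fin_cases j <;> simp_all
    rintro (i | i) (j | j) hij
    · simp at hij
    · exact key i j
    · obtain ⟨x, hx, y, hy, h⟩ := key j i
      exact ⟨y, hy, x, hx, h.symm⟩
    · simp at hij

theorem SimpleGraph.hasMinor_K5 {V : Type*} {G : SimpleGraph V} {v p q y : V} {X : Set V}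
    (hX : (G.induce X).Connected)
    (hvX : v ∉ X) (hpX : p ∉ X) (hqX : q ∉ X) (hyX : y ∉ X)
    (hvp : G.Adj v p) (hvq : G.Adj v q) (hvy : G.Adj v y)
    (hpq : G.Adj p q) (hpy : G.Adj p y) (hqy : G.Adj q y)
    (hv : ∃ x ∈ X, G.Adj v x) (hp : ∃ x ∈ X, G.Adj p x) (hq : ∃ x ∈ X, G.Adj q x)
    (hy : ∃ x ∈ X, G.Adj y x) :
    G.HasMinor (completeGraph (Fin 5)) := by
  have key : ∀ i j : Fin 5, i < j → Disjoint ((![{v}, {p}, {q}, {y}, X] : Fin 5 → Set V) i)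
      ((![{v}, {p}, {q}, {y}, X] : Fin 5 → Set V) j) ∧
      ∃ x ∈ (![{v}, {p}, {q}, {y}, X] : Fin 5 → Set V) i,
        ∃ z ∈ (![{v}, {p}, {q}, {y}, X] : Fin 5 → Set V) j, G.Adj x z := by
    have := hvp.ne; have := hvq.ne; have := hvy.ne
    have := hpq.ne; have := hpy.ne; have := hqy.ne
    intro i j hij
    fin_cases i <;> fin_cases j <;> simp_all
  refine ⟨![{v}, {p}, {q}, {y}, X], ?_, ?_, ?_⟩
  · intro i
    fin_cases i <;> first | exact G.connected_induce_singleton_s3 _ | exact hX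
  · intro i j hij
    rcases lt_or_gt_of_ne hij with h | h
    · exact (key i j h).1
    · exact (key j i h).1.symm
  · intro i j hij
    rcases lt_or_gt_of_ne hij.ne with h | h
    · exact (key i j h).2
    · obtain ⟨x, hx, z, hz, h⟩ := (key j i h).2
      exact ⟨z, hz, x, hx, h.symm⟩

theorem SimpleGraph.hasNCycle_four_iff {V : Type*} {G : SimpleGraph V} :
    G.HasNCycle 4 ↔ ∃ x y z t, G.Adj x y ∧ G.Adj y z ∧ G.Adj z t ∧ G.Adj t x ∧ x ≠ z ∧ y ≠ t := by
  constructor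
  · rintro ⟨v, c, hc, hl⟩
    match c, hc, hl with
    | .cons h₁ (.cons h₂ (.cons h₃ (.cons h₄ .nil))), hc, _ =>
      have := hc.support_nodup
      simp at this
      refine ⟨_, _, _, _, h₁, h₂, h₃, h₄, ?_, ?_⟩ <;> grind
  · rintro ⟨x, y, z, t, h₁, h₂, h₃, h₄, hxz, hyt⟩
    refine ⟨x, .cons h₁ (.cons h₂ (.cons h₃ (.cons h₄ .nil))), ?_, rfl⟩
    have := h₁.ne; have := h₂.ne; have := h₃.ne; have := h₄.ne
    rw [Walk.cons_isCycle_iff]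
    simp
    grind

/-- Two distinct vertices with at least two common neighbours have at least three of them. -/
def SimpleGraph.CommonPairsExtend {V : Type*} (G : SimpleGraph V) : Prop :=
  ∀ ⦃x y p q : V⦄, x ≠ y → p ≠ q → G.Adj x p → G.Adj y p → G.Adj x q → G.Adj y q →
    ∃ r, r ≠ p ∧ r ≠ q ∧ G.Adj x r ∧ G.Adj y r

theorem SimpleGraph.eq_of_adj_of_ncard_neighborSet_le_five {V : Type*} [Finite V]
    {G : SimpleGraph V} {v : V}
    (hN : (G.neighborSet v).ncard ≤ 5) {a b c d e f : V} (ha : G.Adj v a) (hb : G.Adj v b)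
    (hc : G.Adj v c) (hd : G.Adj v d) (he : G.Adj v e) (hf : G.Adj v f)
    (h : [a, b, c, d, e].Nodup) : f = a ∨ f = b ∨ f = c ∨ f = d ∨ f = e := by
  classical
  by_contra hcon
  have h6 : [f, a, b, c, d, e].Nodup := by simp_all
  have hsub : (([f, a, b, c, d, e].toFinset : Finset V) : Set V) ⊆ G.neighborSet v := by
    intro x hx
    simp at hx
    rcases hx with rfl | rfl | rfl | rfl | rfl | rfl <;> assumption
  have := Set.ncard_le_ncard hsub (Set.toFinite _)
  rw [Set.ncard_coe_finset, List.toFinset_card_of_nodup h6] at this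
  simp at this
  omega

theorem SimpleGraph.eq_of_three_common_of_no_K33 {V : Type*} {G : SimpleGraph V}
    (h33 : ¬ G.HasMinor (completeBipartiteGraph (Fin 3) (Fin 3))) {v w u a b c : V}
    (hvw : v ≠ w) (huv : u ≠ v) (hab : a ≠ b) (hac : a ≠ c) (hbc : b ≠ c)
    (hva : G.Adj v a) (hvb : G.Adj v b) (hvc : G.Adj v c)
    (hwa : G.Adj w a) (hwb : G.Adj w b) (hwc : G.Adj w c)
    (hua : G.Adj u a) (hub : G.Adj u b) (huc : G.Adj u c) : u = w := by
  by_contra huw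
  refine h33 (hasMinor_K33 (X := {u}) (G.connected_induce_singleton_s3 u) hvw hab hac hbc
    ?_ ?_ ?_ ?_ ?_ hva hvb hvc hwa hwb hwc ?_ ?_ ?_)
  all_goals simp
  all_goals first | assumption | grind [SimpleGraph.irrefl]

/-- The neighbourhood of a vertex of degree at most five does not contain a triangle `x y p`
together with a further common neighbour `q` of `x` and `y` and a further neighbour `z` of `p`. -/
theorem SimpleGraph.not_two_triangles_in_neighborSet {V : Type*} [Finite V] {G : SimpleGraph V}
    (h5 : ¬ G.HasMinor (completeGraph (Fin 5)))
    (hP : G.CommonPairsExtend) {v : V} (hN : (G.neighborSet v).ncard ≤ 5) {x y p q z : V}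
    (hvx : G.Adj v x) (hvy : G.Adj v y) (hvp : G.Adj v p) (hvq : G.Adj v q) (hvz : G.Adj v z)
    (hxy : G.Adj x y) (hxp : G.Adj x p) (hyp : G.Adj y p)
    (hxq : G.Adj x q) (hyq : G.Adj y q) (hqp : q ≠ p)
    (hpz : G.Adj p z) (hzx : z ≠ x) (hzy : z ≠ y) : False := by
  have K5 : ∀ r, (q = r ∨ G.Adj q r) → G.Adj v r → r ≠ x → r ≠ y → r ≠ p →
      (G.Adj p q ∨ G.Adj p r) → False := by
    intro r hqr hvr h1 h2 h3 h4
    refine h5 (hasMinor_K5 (X := {q, r}) (v := v) (p := x) (q := y) (y := p) ?_ ?_ ?_ ?_ ?_ hvx hvy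
      hvp hxy hxp hyp ?_ ?_ ?_ ?_)
    · rcases hqr with rfl | hqr
      · rw [Set.pair_eq_singleton]
        exact G.connected_induce_singleton_s3 q
      · exact induce_pair_connected_of_adj hqr
    · have := hvq.ne; have := hvr.ne; simp; grind
    · have := hxq.ne; simp; grind
    · have := hyq.ne; simp; grind
    all_goals simp; grind
  have := hxq.ne'; have := hyq.ne'
  obtain ⟨t, htx, hty, hvt, hqt⟩ := hP hvq.ne hxy.ne hvx hxq.symm hvy hyq.symm
  have h1 := K5 q
  have h2 := K5 t
  have := hqt.ne; have := hpz.ne; have := hxy.ne; have := hxp.ne; have := hyp.ne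
  have hpq : ¬ G.Adj p q := by grind
  have htp : t ≠ p := by rintro rfl; exact hpq hqt.symm
  have := G.eq_of_adj_of_ncard_neighborSet_le_five hN hvx hvy hvp hvq hvt hvz (by simp; grind)
  grind

theorem SimpleGraph.exists_two_adj_ne {V : Type*} {G : SimpleGraph V} (hP : G.CommonPairsExtend)
    {v x p q : V} (y : V) (hvx : G.Adj v x) (hpq : p ≠ q) (hvp : G.Adj v p) (hvq : G.Adj v q)
    (hxp : G.Adj x p) (hxq : G.Adj x q) :
    ∃ p₁ p₂, p₁ ≠ p₂ ∧ p₁ ≠ y ∧ p₂ ≠ y ∧ G.Adj v p₁ ∧ G.Adj v p₂ ∧ G.Adj x p₁ ∧ G.Adj x p₂ := by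
  obtain ⟨r, hrp, hrq, hvr, hxr⟩ := hP hvx.ne hpq hvp hxp hvq hxq
  by_cases hp : p = y
  · exact ⟨q, r, hrq.symm, by grind, by grind, hvq, hvr, hxq, hxr⟩
  · by_cases hq : q = y
    · exact ⟨p, r, hrp.symm, hp, by grind, hvp, hvr, hxp, hxr⟩
    · exact ⟨p, q, hpq, hp, hq, hvp, hvq, hxp, hxq⟩

/-- At most one neighbour of a vertex of degree at most five has two common neighbours with it. -/
theorem SimpleGraph.eq_of_two_common_of_adj {V : Type*} [Finite V] {G : SimpleGraph V}
    (h5 : ¬ G.HasMinor (completeGraph (Fin 5)))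
    (h33 : ¬ G.HasMinor (completeBipartiteGraph (Fin 3) (Fin 3)))
    (hP : G.CommonPairsExtend) {v : V} (hN : (G.neighborSet v).ncard ≤ 5) {x y p q s t : V}
    (hvx : G.Adj v x) (hvy : G.Adj v y)
    (hpq : p ≠ q) (hvp : G.Adj v p) (hvq : G.Adj v q) (hxp : G.Adj x p) (hxq : G.Adj x q)
    (hst : s ≠ t) (hvs : G.Adj v s) (hvt : G.Adj v t) (hys : G.Adj y s) (hyt : G.Adj y t) :
    x = y := by
  by_contra hxy
  by_cases hadj : G.Adj x y
  · obtain ⟨p, hvp, hxp, hyp⟩ : ∃ p, G.Adj v p ∧ G.Adj x p ∧ G.Adj y p := by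
      obtain ⟨p₁, p₂, h1, h2, h3, h4, h5, h6, h7⟩ := exists_two_adj_ne hP y hvx hpq hvp hvq hxp hxq
      obtain ⟨q₁, q₂, g1, g2, g3, g4, g5, g6, g7⟩ := exists_two_adj_ne hP x hvy hst hvs hvt hys hyt
      have := h6.ne; have := h7.ne; have := g6.ne; have := g7.ne
      by_contra hno
      push Not at hno
      have := hno p₁ h4 h6
      have := hno p₂ h5 h7
      have hnod : [x, y, p₁, p₂, q₁].Nodup := by simp; grind
      rcases G.eq_of_adj_of_ncard_neighborSet_le_five hN hvx hvy h4 h5 g4 g5 hnod with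
        rfl | rfl | rfl | rfl | rfl <;> simp_all
    have := hadj.ne; have := hxp.ne; have := hyp.ne
    obtain ⟨q, hqy, hqp, hvq, hxq⟩ := hP hvx.ne hyp.ne hvy hadj hvp hxp
    obtain ⟨r, hrx, hrp, hvr, hyr⟩ := hP hvy.ne hxp.ne hvx hadj.symm hvp hyp
    obtain ⟨z, hzx, hzy, hvz, hpz⟩ := hP hvp.ne hadj.ne hvx hxp.symm hvy hyp.symm
    have := hxq.ne; have := hyr.ne; have := hpz.ne
    by_cases hqr : q = r
    · subst hqr
      exact not_two_triangles_in_neighborSet h5 hP hN hvx hvy hvp hvq hvz hadj hxp hyp hxq hyr hqp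
        hpz hzx hzy
    by_cases hqz : q = z
    · subst hqz
      exact not_two_triangles_in_neighborSet h5 hP hN hvx hvp hvy hvq hvr hxp hadj hyp.symm hxq hpz
        hqy hyr hrx hrp
    by_cases hrz : r = z
    · subst hrz
      exact not_two_triangles_in_neighborSet h5 hP hN hvy hvp hvx hvr hvq hyp hadj.symm hxp.symm
        hyr hpz hrx hxq hqy hqp
    have := G.eq_of_adj_of_ncard_neighborSet_le_five hN hvx hvy hvp hvq hvr hvz (by simp; grind)
    grind
  · obtain ⟨p', hp'p, hp'q, hvp', hxp'⟩ := hP hvx.ne hpq hvp hxp hvq hxq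
    obtain ⟨s', hs's, hs't, hvs', hys'⟩ := hP hvy.ne hst hvs hys hvt hyt
    have := hxp.ne; have := hxq.ne; have := hxp'.ne
    have := hys.ne; have := hyt.ne; have := hys'.ne
    have hnod : [x, y, p, q, p'].Nodup := by simp; grind [SimpleGraph.Adj.symm]
    have h1 := G.eq_of_adj_of_ncard_neighborSet_le_five hN hvx hvy hvp hvq hvp' hvs hnod
    have h2 := G.eq_of_adj_of_ncard_neighborSet_le_five hN hvx hvy hvp hvq hvp' hvt hnod
    have h3 := G.eq_of_adj_of_ncard_neighborSet_le_five hN hvx hvy hvp hvq hvp' hvs' hnod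
    have hall : G.Adj y p ∧ G.Adj y q ∧ G.Adj y p' := by grind [SimpleGraph.Adj.symm]
    exact hxy (eq_of_three_common_of_no_K33 h33 hvy.ne hvx.ne' hpq hp'p.symm hp'q.symm hvp hvq
      hvp' hall.1 hall.2.1 hall.2.2 hxp hxq hxp')

/-- Two vertices `u₁`, `u₂` with a common neighbour `d` cannot jointly see three common neighbours
of `v` and `w`. -/
theorem SimpleGraph.false_of_bridge {V : Type*} {G : SimpleGraph V}
    (h33 : ¬ G.HasMinor (completeBipartiteGraph (Fin 3) (Fin 3))) {v w a b c d u₁ u₂ : V}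
    (hvw : v ≠ w) (hab : a ≠ b) (hac : a ≠ c) (hbc : b ≠ c)
    (hva : G.Adj v a) (hvb : G.Adj v b) (hvc : G.Adj v c)
    (hwa : G.Adj w a) (hwb : G.Adj w b) (hwc : G.Adj w c)
    (hv₁ : u₁ ≠ v) (hv₂ : u₂ ≠ v) (hw₁ : u₁ ≠ w) (hw₂ : u₂ ≠ w) (hvd : v ≠ d) (hwd : w ≠ d)
    (hda : d ≠ a) (hdb : d ≠ b) (hdc : d ≠ c)
    (h₁d : G.Adj u₁ d) (h₂d : G.Adj u₂ d)
    (h₁c : u₁ ≠ c) (h₂a : u₂ ≠ a) (h₂b : u₂ ≠ b)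
    (h₁a : G.Adj u₁ a) (h₁b : G.Adj u₁ b) (h₂c : G.Adj u₂ c) : False := by
  have := h₁a.ne; have := h₁b.ne; have := h₂c.ne
  refine h33 (hasMinor_K33 (X := {u₁, d, u₂})
    ((induce_pair_connected_of_adj h₂d.symm).induce_insert (Set.mem_insert _ _) h₁d) hvw hab hac hbc
    ?_ ?_ ?_ ?_ ?_ hva hvb hvc hwa hwb hwc ?_ ?_ ?_)
  all_goals simp
  all_goals grind

/-- Auxiliary configuration: `u₁`, `u₂`, `u₃` extend the three pairs of common neighbours
`a`, `b`, `c` of `v` and `w`, where `u₃` and `u₁` see a further common neighbour `d` of `v`. -/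
theorem SimpleGraph.false_of_three_extensions_aux {V : Type*} [Finite V] {G : SimpleGraph V}
    (h5 : ¬ G.HasMinor (completeGraph (Fin 5)))
    (h33 : ¬ G.HasMinor (completeBipartiteGraph (Fin 3) (Fin 3)))
    (hP : G.CommonPairsExtend) {v : V} (hN : (G.neighborSet v).ncard ≤ 5)
    {w a b c d e u₁ u₂ u₃ : V} (hvw : v ≠ w) (hwN : ¬ G.Adj v w)
    (hab : a ≠ b) (hac : a ≠ c) (hbc : b ≠ c)
    (hva : G.Adj v a) (hvb : G.Adj v b) (hvc : G.Adj v c)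
    (hwa : G.Adj w a) (hwb : G.Adj w b) (hwc : G.Adj w c)
    (h₁v : u₁ ≠ v) (h₁w : u₁ ≠ w) (h₁a : G.Adj u₁ a) (h₁b : G.Adj u₁ b) (h₁N : ¬ G.Adj v u₁)
    (h₂v : u₂ ≠ v) (h₂w : u₂ ≠ w) (h₂b : G.Adj u₂ b) (h₂c : G.Adj u₂ c) (h₂N : ¬ G.Adj v u₂)
    (h₃v : u₃ ≠ v) (h₃w : u₃ ≠ w) (h₃c : G.Adj u₃ c) (h₃a : G.Adj u₃ a)
    (hvd : G.Adj v d) (hda : d ≠ a) (hdb : d ≠ b) (hdc : d ≠ c)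
    (hve : G.Adj v e) (hea : e ≠ a) (heb : e ≠ b) (hec : e ≠ c)
    (h₁d : G.Adj u₁ d) (h₂e : G.Adj u₂ e) (h₃d : G.Adj u₃ d) : False := by
  have hwd : w ≠ d := by rintro rfl; exact hwN hvd
  have hwe : w ≠ e := by rintro rfl; exact hwN hve
  have hde : d ≠ e := by
    rintro rfl
    exact false_of_bridge h33 hvw hab hac hbc hva hvb hvc hwa hwb hwc h₁v h₂v h₁w h₂w hvd.ne hwd
      hda hdb hdc h₁d h₂e (by grind) (by grind) (by grind) h₁a h₁b h₂c
  have h₃b : u₃ = b := by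
    by_contra h₃b
    exact false_of_bridge h33 hvw hab hac hbc hva hvb hvc hwa hwb hwc h₁v h₃v h₁w h₃w hvd.ne hwd
      hda hdb hdc h₁d h₃d (by grind) h₃a.ne h₃b h₁a h₁b h₃c
  subst h₃b
  have hwd' : ¬ G.Adj w d := fun h =>
    h₁w (eq_of_three_common_of_no_K33 h33 hvw h₁v hab hda.symm hdb.symm hva hvb hvd hwa hwb h
      h₁a h₁b h₁d)
  obtain ⟨u, huv, hu₁, hbu, hdu⟩ := hP hdb.symm h₁v.symm hvb.symm hvd.symm h₁b.symm h₁d.symm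
  have huN : ¬ G.Adj v u := fun h => hbu.ne
    (eq_of_two_common_of_adj h5 h33 hP hN h hvb hdb hvd hvb hdu.symm hbu.symm hac hva hvc h₃a
      h₃c).symm
  have huw : u ≠ w := by rintro rfl; exact hwd' hdu.symm
  have hua : ¬ G.Adj u a := fun h =>
    hu₁ (eq_of_three_common_of_no_K33 h33 h₁v.symm huv hab hda.symm hdb.symm hva hvb hvd h₁a h₁b h₁d
      h hbu.symm hdu.symm)
  obtain ⟨f, hfb, hfd, hvf, huf⟩ := hP huv.symm hdb.symm hvb hbu.symm hvd hdu.symm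
  have hf : f = c ∨ f = e := by
    have := eq_of_adj_of_ncard_neighborSet_le_five hN hva hvb hvc hvd hve hvf (by simp; grind)
    grind
  rcases hf with rfl | rfl
  · exact false_of_bridge h33 hvw hab hac hbc hva hvb hvc hwa hwb hwc h₁v huv h₁w huw hvd.ne hwd
      hda hdb hdc h₁d hdu.symm (by grind) (by grind) hbu.ne' h₁a h₁b huf
  · refine h33 (hasMinor_K33 (X := {u₁, d, u, f, u₂})
      ((((induce_pair_connected_of_adj h₂e.symm).induce_insert (Set.mem_insert _ _)
        huf).induce_insert (Set.mem_insert _ _) hdu).induce_insert (Set.mem_insert _ _) h₁d)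
      hvw hab hac hbc ?_ ?_ ?_ ?_ ?_ hva hvb hvc hwa hwb hwc ?_ ?_ ?_)
    · have := hvd.ne; have := hve.ne; simp; grind
    · simp; grind
    · simp; grind
    · simp; grind
    · simp; grind
    all_goals simp
    all_goals grind

theorem SimpleGraph.false_of_three_extensions {V : Type*} [Finite V] {G : SimpleGraph V}
    (h5 : ¬ G.HasMinor (completeGraph (Fin 5)))
    (h33 : ¬ G.HasMinor (completeBipartiteGraph (Fin 3) (Fin 3)))
    (hP : G.CommonPairsExtend) {v : V} (hN : (G.neighborSet v).ncard ≤ 5)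
    {w a b c u₁ u₂ u₃ : V} (hvw : v ≠ w) (hwN : ¬ G.Adj v w)
    (hab : a ≠ b) (hac : a ≠ c) (hbc : b ≠ c)
    (hva : G.Adj v a) (hvb : G.Adj v b) (hvc : G.Adj v c)
    (hwa : G.Adj w a) (hwb : G.Adj w b) (hwc : G.Adj w c)
    (h₁v : u₁ ≠ v) (h₁w : u₁ ≠ w) (h₁a : G.Adj u₁ a) (h₁b : G.Adj u₁ b) (h₁N : ¬ G.Adj v u₁)
    (h₂v : u₂ ≠ v) (h₂w : u₂ ≠ w) (h₂b : G.Adj u₂ b) (h₂c : G.Adj u₂ c) (h₂N : ¬ G.Adj v u₂)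
    (h₃v : u₃ ≠ v) (h₃w : u₃ ≠ w) (h₃c : G.Adj u₃ c) (h₃a : G.Adj u₃ a) : False := by
  have no3 : ∀ {u}, u ≠ v → u ≠ w → G.Adj u a → G.Adj u b → G.Adj u c → False :=
    fun hv hw ha hb hc => hw
      (eq_of_three_common_of_no_K33 h33 hvw hv hab hac hbc hva hvb hvc hwa hwb hwc ha hb hc)
  obtain ⟨d, hda, hdb, hvd, h₁d⟩ := hP h₁v.symm hab hva h₁a hvb h₁b
  obtain ⟨e, heb, hec, hve, h₂e⟩ := hP h₂v.symm hbc hvb h₂b hvc h₂c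
  obtain ⟨f, hfc, hfa, hvf, h₃f⟩ := hP h₃v.symm hac.symm hvc h₃c hva h₃a
  have hdc : d ≠ c := by rintro rfl; exact no3 h₁v h₁w h₁a h₁b h₁d
  have hea : e ≠ a := by rintro rfl; exact no3 h₂v h₂w h₂e h₂b h₂c
  have hfb : f ≠ b := by rintro rfl; exact no3 h₃v h₃w h₃a h₃f h₃c
  have hwd : w ≠ d := by rintro rfl; exact hwN hvd
  have hde : d ≠ e := by
    rintro rfl
    exact false_of_bridge h33 hvw hab hac hbc hva hvb hvc hwa hwb hwc h₁v h₂v h₁w h₂w hvd.ne hwd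
      hda hdb hdc h₁d h₂e (by grind) (by grind) (by grind) h₁a h₁b h₂c
  have hf : f = d ∨ f = e := by
    have := eq_of_adj_of_ncard_neighborSet_le_five hN hva hvb hvc hvd hve hvf (by simp; grind)
    grind
  rcases hf with rfl | rfl
  · exact false_of_three_extensions_aux h5 h33 hP hN hvw hwN hab hac hbc hva hvb hvc hwa hwb hwc
      h₁v h₁w h₁a h₁b h₁N h₂v h₂w h₂b h₂c h₂N h₃v h₃w h₃c h₃a hvd hda hdb hdc hve hea heb hec
      h₁d h₂e h₃f
  · exact false_of_three_extensions_aux h5 h33 hP hN hvw hwN hbc.symm hac.symm hab.symm hvc hvb hva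
      hwc hwb hwa h₂v h₂w h₂c h₂b h₂N h₁v h₁w h₁b h₁a h₁N h₃v h₃w h₃a h₃c hve hec heb hea
      hvd hdc hdb hda h₂e h₁d h₃f

/-- In a graph without `K₅` and `K₃,₃` minors where no two vertices have exactly two common
neighbours, a vertex of degree at most five lies on no 4-cycle. -/
theorem SimpleGraph.eq_of_two_common_of_ncard_neighborSet_le_five {V : Type*} [Finite V]
    {G : SimpleGraph V}
    (h5 : ¬ G.HasMinor (completeGraph (Fin 5)))
    (h33 : ¬ G.HasMinor (completeBipartiteGraph (Fin 3) (Fin 3)))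
    (hP : G.CommonPairsExtend) {v : V} (hN : (G.neighborSet v).ncard ≤ 5) {w a b : V}
    (hvw : v ≠ w) (hva : G.Adj v a) (hvb : G.Adj v b) (hwa : G.Adj w a) (hwb : G.Adj w b) :
    a = b := by
  by_contra hab
  have hone : ∀ {x y p q s t}, x ≠ y → p ≠ q → G.Adj v p → G.Adj v q → G.Adj x p → G.Adj x q →
      s ≠ t → G.Adj v s → G.Adj v t → G.Adj y s → G.Adj y t → G.Adj v x → G.Adj v y → False :=
    fun hxy hpq hvp hvq hxp hxq hst hvs hvt hys hyt hvx hvy =>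
      hxy (eq_of_two_common_of_adj h5 h33 hP hN hvx hvy hpq hvp hvq hxp hxq hst hvs hvt hys hyt)
  wlog hwN : ¬ G.Adj v w generalizing w
  · obtain ⟨u, huv, huw, hau, hbu⟩ := hP hab hvw hva.symm hvb.symm hwa.symm hwb.symm
    exact this huv.symm hau.symm hbu.symm
      (hone huw.symm hab hva hvb hwa hwb hab hva hvb hau.symm hbu.symm (not_not.mp hwN))
  obtain ⟨c, hca, hcb, hvc, hwc⟩ := hP hvw hab hva hwa hvb hwb
  have no3 : ∀ {u}, u ≠ v → u ≠ w → G.Adj u a → G.Adj u b → G.Adj u c → False :=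
    fun hv hw ha hb hc => hw (eq_of_three_common_of_no_K33 h33 hvw hv hab hca.symm hcb.symm
      hva hvb hvc hwa hwb hwc ha hb hc)
  obtain ⟨u₁, h₁v, h₁w, ha₁, hb₁⟩ := hP hab hvw hva.symm hvb.symm hwa.symm hwb.symm
  obtain ⟨u₂, h₂v, h₂w, hb₂, hc₂⟩ := hP hcb.symm hvw hvb.symm hvc.symm hwb.symm hwc.symm
  obtain ⟨u₃, h₃v, h₃w, hc₃, ha₃⟩ := hP hca hvw hvc.symm hva.symm hwc.symm hwa.symm
  replace ha₁ := ha₁.symm; replace hb₁ := hb₁.symm; replace hb₂ := hb₂.symm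
  replace hc₂ := hc₂.symm; replace hc₃ := hc₃.symm; replace ha₃ := ha₃.symm
  have h₁₂ : u₁ ≠ u₂ := by rintro rfl; exact no3 h₁v h₁w ha₁ hb₁ hc₂
  have h₂₃ : u₂ ≠ u₃ := by rintro rfl; exact no3 h₂v h₂w ha₃ hb₂ hc₂
  have h₁₃ : u₁ ≠ u₃ := by rintro rfl; exact no3 h₁v h₁w ha₁ hb₁ hc₃
  have n₁₂ := hone h₁₂ hab hva hvb ha₁ hb₁ hcb.symm hvb hvc hb₂ hc₂
  have n₂₃ := hone h₂₃ hcb.symm hvb hvc hb₂ hc₂ hca hvc hva hc₃ ha₃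
  have n₁₃ := hone h₁₃ hab hva hvb ha₁ hb₁ hca hvc hva hc₃ ha₃
  by_cases n₁ : G.Adj v u₁
  · exact false_of_three_extensions h5 h33 hP hN hvw hwN hcb.symm (Ne.symm hab) hca hvb hvc hva
      hwb hwc hwa h₂v h₂w hb₂ hc₂ (n₁₂ n₁) h₃v h₃w hc₃ ha₃ (n₁₃ n₁) h₁v h₁w ha₁ hb₁
  by_cases n₂ : G.Adj v u₂
  · exact false_of_three_extensions h5 h33 hP hN hvw hwN hca hcb hab hvc hva hvb hwc hwa
      hwb h₃v h₃w hc₃ ha₃ (n₂₃ n₂) h₁v h₁w ha₁ hb₁ n₁ h₂v h₂w hb₂ hc₂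
  exact false_of_three_extensions h5 h33 hP hN hvw hwN hab hca.symm hcb.symm hva hvb hvc hwa hwb hwc
    h₁v h₁w ha₁ hb₁ n₁ h₂v h₂w hb₂ hc₂ n₂ h₃v h₃w hc₃ ha₃

/-- A vertex of degree at most five, each of whose edges lies in three triangles, gives a `K₅`
minor. -/
theorem SimpleGraph.hasMinor_K5_of_three_le_ncard_commonNeighbors {V : Type*} [Finite V]
    {G : SimpleGraph V} {v x : V} (hN : (G.neighborSet v).ncard ≤ 5) (hvx : G.Adj v x)
    (h3 : ∀ u, G.Adj v u → 3 ≤ (G.commonNeighbors v u).ncard) :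
    G.HasMinor (completeGraph (Fin 5)) := by
  by_contra h5
  have three : ∀ u, G.Adj v u → ∃ p q r, G.Adj v p ∧ G.Adj v q ∧ G.Adj v r ∧
      G.Adj u p ∧ G.Adj u q ∧ G.Adj u r ∧ p ≠ q ∧ p ≠ r ∧ q ≠ r := by
    intro u hu
    obtain ⟨p, q, r, hp, hq, hr, h⟩ := (Set.two_lt_ncard_iff (Set.toFinite _)).1 (h3 u hu)
    exact ⟨p, q, r, hp.1, hq.1, hr.1, hp.2, hq.2, hr.2, h⟩
  have miss : ∀ {a b c}, G.Adj v a → G.Adj v b → G.Adj v c → a ≠ b → a ≠ c → b ≠ c →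
      G.Adj a b ∨ G.Adj a c := by
    intro a b c ha hb hc hab hac hbc
    by_contra! hno
    obtain ⟨p, q, r, hp, hq, hr, hap, haq, har, hpq, hpr, hqr⟩ := three a ha
    have := hap.ne; have := haq.ne; have := har.ne
    have := eq_of_adj_of_ncard_neighborSet_le_five hN ha hb hc hp hq hr (by simp; grind)
    grind
  have K5 : ∀ {p q y r s}, G.Adj v p → G.Adj v q → G.Adj v y → G.Adj v r → G.Adj v s →
      G.Adj p q → G.Adj p y → G.Adj q y → (r = s ∨ G.Adj r s) → (G.Adj p r ∨ G.Adj p s) →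
      (G.Adj q r ∨ G.Adj q s) → (G.Adj y r ∨ G.Adj y s) → r ≠ p → r ≠ q → r ≠ y → s ≠ p → s ≠ q →
      s ≠ y → False := by
    intro p q y r s hp hq hy hr hs hpq hpy hqy hrs h1 h2 h3 _ _ _ _ _ _
    refine h5 (hasMinor_K5 (X := {r, s}) ?_ ?_ ?_ ?_ ?_ hp hq hy hpq hpy hqy ?_ ?_ ?_ ?_)
    · rcases hrs with rfl | hrs
      · rw [Set.pair_eq_singleton]
        exact G.connected_induce_singleton_s3 r
      · exact induce_pair_connected_of_adj hrs
    · have := hr.ne; have := hs.ne; simp; grind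
    all_goals simp; grind
  obtain ⟨p, q, r, hp, hq, hr, hxp, hxq, hxr, hpq, hpr, hqr⟩ := three x hvx
  have hpx := hxp.ne'; have hqx := hxq.ne'; have hrx := hxr.ne'
  by_cases hy : ∃ y, G.Adj v y ∧ y ≠ x ∧ y ≠ p ∧ y ≠ q ∧ y ≠ r
  · obtain ⟨y, hvy, hyx, hyp, hyq, hyr⟩ := hy
    by_cases hxy : G.Adj x y
    · have of_matching : ∀ {p q r}, G.Adj v p → G.Adj v q → G.Adj v r → G.Adj x p → G.Adj x q →
          p ≠ q → p ≠ r → q ≠ r → y ≠ p → y ≠ q → y ≠ r → r ≠ x →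
          G.Adj x r → G.Adj p q → G.Adj r y → False := by
        intro p q r hp hq hr hxp hxq hpq hpr hqr hyp hyq hyr hrx hxr hpq' hry
        exact K5 hvx hp hq hr hvy hxp hxq hpq' (.inr hry) (.inl hxr)
          (miss hp hr hvy hpr hyp.symm hyr.symm) (miss hq hr hvy hqr hyq.symm hyr.symm)
          hrx hpr.symm hqr.symm hyx hyp hyq
      have m1 := miss hp hq hr hpq hpr hqr
      have m2 := miss hvy hq hr hyq hyr hqr
      have m3 := miss hp hq hvy hpq hyp.symm hyq.symm
      have m4 := miss hvy hp hr hyp hyr hpr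
      have m5 := miss hvy hp hq hyp hyq hpq
      have m6 := miss hr hp hq hpr.symm hqr.symm hpq
      have m7 := miss hq hp hr hpq.symm hqr hpr
      have n1 := of_matching hp hq hr hxp hxq hpq hpr hqr hyp hyq hyr hrx hxr
      have n2 := of_matching hp hr hq hxp hxr hpr hpq hqr.symm hyp hyr hyq hqx hxq
      have n3 := of_matching hq hr hp hxq hxr hqr hpq.symm hpr.symm hyq hyr hyp hpx hxp
      clear three miss K5 of_matching
      grind [SimpleGraph.adj_comm]
    · have hyp' := (miss hvy hvx hp hyx hyp hpx.symm).resolve_left fun h => hxy h.symm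
      have hyq' := (miss hvy hvx hq hyx hyq hqx.symm).resolve_left fun h => hxy h.symm
      have hyr' := (miss hvy hvx hr hyx hyr hrx.symm).resolve_left fun h => hxy h.symm
      rcases miss hp hq hr hpq hpr hqr with h | h
      · exact K5 hp hq hvy hr hvx h hyp'.symm hyq'.symm (.inr hxr.symm) (.inr hxp.symm)
          (.inr hxq.symm) (.inl hyr') hpr.symm hqr.symm hyr.symm hpx.symm hqx.symm hyx.symm
      · exact K5 hp hr hvy hq hvx h hyp'.symm hyr'.symm (.inr hxq.symm) (.inr hxp.symm)
          (.inr hxr.symm) (.inl hyq') hpq.symm hqr hyq.symm hpx.symm hrx.symm hyx.symm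
  · have hy' : ∀ y, G.Adj v y → y = x ∨ y = p ∨ y = q ∨ y = r := by
      intro y hvy
      by_contra! hne
      exact hy ⟨y, hvy, hne⟩
    obtain ⟨hpq', hpr'⟩ : G.Adj p q ∧ G.Adj p r := by
      obtain ⟨a, b, c, ha, hb, hc, hpa, hpb, hpc, hab, hac, hbc⟩ := three p hp
      have := hpa.ne; have := hpb.ne; have := hpc.ne
      have := hy' a ha; have := hy' b hb; have := hy' c hc
      clear three miss K5 hy hy' h3
      grind
    have hqr' : G.Adj q r := by
      obtain ⟨a, b, c, ha, hb, hc, hqa, hqb, hqc, hab, hac, hbc⟩ := three q hq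
      have := hqa.ne; have := hqb.ne; have := hqc.ne
      have := hy' a ha; have := hy' b hb; have := hy' c hc
      clear three miss K5 hy hy' h3
      grind
    exact K5 hvx hp hq hr hr hxp hxq hpq' (.inl rfl) (.inl hxr) (.inl hpr') (.inl hqr') hrx
      hpr.symm hqr.symm hrx hpr.symm hqr.symm

/-- Contraction of `u` into `v`; the vertex `u` becomes isolated. -/
def SimpleGraph.contractInto {V : Type*} (G : SimpleGraph V) (v u : V) : SimpleGraph V where
  Adj x y := x ≠ u ∧ y ≠ u ∧ x ≠ y ∧ (G.Adj x y ∨ (x = v ∧ G.Adj u y) ∨ (y = v ∧ G.Adj u x))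
  symm := ⟨fun x y h => ⟨h.2.1, h.1, h.2.2.1.symm, by
    rcases h.2.2.2 with h | h | h
    · exact .inl h.symm
    · exact .inr (.inr h)
    · exact .inr (.inl h)⟩⟩
  loopless := ⟨fun x h => h.2.2.1 rfl⟩

theorem SimpleGraph.HasMinor.of_contractInto {V W : Type*} [Nontrivial W] {G : SimpleGraph V}
    {v u : V} (hvu : G.Adj v u) (hm : (G.contractInto v u).HasMinor (completeGraph W)) :
    G.HasMinor (completeGraph W) := by
  classical
  obtain ⟨f, hc, hd, ha⟩ := hm
  have hu : ∀ w, u ∉ f w := by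
    intro w huw
    obtain ⟨w', hw'⟩ := exists_ne w
    obtain ⟨x, hx, y, hy, hxy⟩ := ha (w₁ := w) (w₂ := w') hw'.symm
    obtain ⟨p⟩ := (hc w).preconnected ⟨u, huw⟩ ⟨x, hx⟩
    cases p with
    | nil => exact hxy.1 rfl
    | cons h _ => exact h.1 rfl
  let g : W → Set V := fun w => {x | x ∈ f w ∨ (x = u ∧ v ∈ f w)}
  have hfg : ∀ {w x}, x ∈ f w → x ∈ g w := fun h => .inl h
  refine ⟨g, fun w => ?_, fun w₁ w₂ hw => ?_, fun w₁ w₂ hw => ?_⟩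
  · have step : ∀ x y : f w, ((G.contractInto v u).induce (f w)).Adj x y →
        (G.induce (g w)).Reachable ⟨x, hfg x.2⟩ ⟨y, hfg y.2⟩ := by
      rintro ⟨x, hx⟩ ⟨y, hy⟩ ⟨-, -, -, h | ⟨rfl, h⟩ | ⟨rfl, h⟩⟩
      · exact Adj.reachable (by exact h)
      · have h1 : (G.induce (g w)).Adj ⟨x, hfg hx⟩ ⟨u, .inr ⟨rfl, hx⟩⟩ := hvu
        have h2 : (G.induce (g w)).Adj ⟨u, .inr ⟨rfl, hx⟩⟩ ⟨y, hfg hy⟩ := h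
        exact h1.reachable.trans h2.reachable
      · have h1 : (G.induce (g w)).Adj ⟨y, hfg hy⟩ ⟨u, .inr ⟨rfl, hy⟩⟩ := hvu
        have h2 : (G.induce (g w)).Adj ⟨u, .inr ⟨rfl, hy⟩⟩ ⟨x, hfg hx⟩ := h
        exact (h1.reachable.trans h2.reachable).symm
    have walk : ∀ x y : f w, ((G.contractInto v u).induce (f w)).Walk x y →
        (G.induce (g w)).Reachable ⟨x, hfg x.2⟩ ⟨y, hfg y.2⟩ := by
      intro x y p
      induction p with
      | nil => rfl
      | cons h _ ih => exact (step _ _ h).trans ih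
    obtain ⟨z⟩ := (hc w).nonempty
    by_cases hv : v ∈ f w
    · rw [connected_iff_exists_forall_reachable]
      refine ⟨⟨v, hfg hv⟩, ?_⟩
      rintro ⟨x, hx | ⟨rfl, -⟩⟩
      · exact walk _ _ ((hc w).preconnected ⟨v, hv⟩ ⟨x, hx⟩).some
      · exact Adj.reachable (by exact hvu)
    · rw [connected_iff_exists_forall_reachable]
      refine ⟨⟨z, hfg z.2⟩, ?_⟩
      rintro ⟨x, hx | ⟨-, hx⟩⟩
      · exact walk _ _ ((hc w).preconnected z ⟨x, hx⟩).some
      · exact absurd hx hv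
  · have hdis := Set.disjoint_left.1 (hd hw)
    refine Set.disjoint_left.2 ?_
    rintro x (hx | ⟨rfl, hx⟩) (hx' | ⟨h, hx'⟩)
    · exact hdis hx hx'
    · exact hu _ (h ▸ hx)
    · exact hu _ hx'
    · exact hdis hx hx'
  · obtain ⟨x, hx, y, hy, -, -, -, h | ⟨rfl, h⟩ | ⟨rfl, h⟩⟩ := ha hw
    · exact ⟨x, hfg hx, y, hfg hy, h⟩
    · exact ⟨u, .inr ⟨rfl, hx⟩, y, hfg hy, h⟩
    · exact ⟨x, hfg hx, u, .inr ⟨rfl, hy⟩, h.symm⟩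

theorem SimpleGraph.ncard_edgeSet_le_contractInto {V : Type*} [Finite V] {G : SimpleGraph V}
    {v u : V} (hvu : G.Adj v u) : G.edgeSet.ncard ≤
      (G.contractInto v u).edgeSet.ncard + (G.commonNeighbors v u).ncard + 1 := by
  classical
  set B : Set (Sym2 V) := insert s(v, u) ((fun y => s(u, y)) '' G.commonNeighbors v u) with hB
  have h1 : B.ncard ≤ (G.commonNeighbors v u).ncard + 1 :=
    (Set.ncard_insert_le _ _).trans (Nat.add_le_add_right (Set.ncard_image_le (Set.toFinite _)) 1)
  have h2 : (G.edgeSet \ B).ncard ≤ (G.contractInto v u).edgeSet.ncard := by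
    refine Set.ncard_le_ncard_of_injOn (Sym2.map fun x => if x = u then v else x) ?_ ?_
      (Set.toFinite _)
    · intro e
      induction e with | _ x y
      rintro ⟨he, hn⟩
      have hxy : G.Adj x y := he
      have hne := hxy.ne
      have hvu' := hvu.ne
      simp only [hB, Set.mem_insert_iff, Sym2.eq_iff, not_or] at hn
      simp only [Sym2.map_mk, mem_edgeSet, contractInto]
      grind [SimpleGraph.adj_comm]
    · intro e
      induction e with | _ x y
      rintro ⟨he, hn⟩ e'
      induction e' with | _ x' y'
      rintro ⟨he', hn'⟩ heq
      have hxy : G.Adj x y := he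
      have hxy' : G.Adj x' y' := he'
      have hne := hxy.ne; have hne' := hxy'.ne
      have mem : ∀ z, s(u, z) ∉ B → G.Adj u z → ¬ G.Adj v z := by
        intro z hz huz hvz
        exact hz (.inr ⟨z, ⟨hvz, huz⟩, rfl⟩)
      have m1 := mem x; have m2 := mem y; have m3 := mem x'; have m4 := mem y'
      have b1 : s(u, v) ∈ B := .inl Sym2.eq_swap
      simp only [Sym2.map_mk, Sym2.eq_iff] at heq ⊢
      have c1 : s(y, x) = s(x, y) := Sym2.eq_swap
      have c2 : s(y', x') = s(x', y') := Sym2.eq_swap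
      grind [SimpleGraph.adj_comm]
  have := Set.ncard_le_ncard_sdiff_add_ncard G.edgeSet B (Set.toFinite _)
  omega

theorem SimpleGraph.exists_ncard_neighborSet_le_five {V : Type*} [Finite V] {G : SimpleGraph V}
    {s : Set V} (h : G.edgeSet.ncard < 3 * s.ncard) :
    ∃ v ∈ s, (G.neighborSet v).ncard ≤ 5 := by
  classical
  have := Fintype.ofFinite V
  by_contra! hcon
  have hsum := G.sum_degrees_eq_twice_card_edges
  rw [← Set.ncard_coe_finset, coe_edgeFinset] at hsum
  have h1 : ∑ v ∈ s.toFinset, 6 ≤ ∑ v ∈ s.toFinset, G.degree v := by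
    refine Finset.sum_le_sum fun v hv => ?_
    have := hcon v (by simpa using hv)
    rw [← card_neighborSet_eq_degree, ← Nat.card_eq_fintype_card, Nat.card_coe_set_eq]
    omega
  have h2 : ∑ v ∈ s.toFinset, G.degree v ≤ ∑ v, G.degree v :=
    Finset.sum_le_sum_of_subset (Finset.subset_univ _)
  rw [Finset.sum_const, ← Set.ncard_eq_toFinset_card'] at h1
  simp at h1
  omega

/-- A graph on `n + 1` vertices without `K₅` minor has at most `3 * n` edges. -/
theorem SimpleGraph.ncard_edgeSet_le_of_not_hasMinor_K5 {V : Type*} [Finite V] (n : ℕ) :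
    ∀ {G : SimpleGraph V} {s : Set V}, ¬ G.HasMinor (completeGraph (Fin 5)) → G.support ⊆ s →
      s.ncard = n + 1 → G.edgeSet.ncard ≤ 3 * n := by
  induction n with
  | zero =>
    intro G s _ hs hn
    obtain ⟨x, rfl⟩ := Set.ncard_eq_one.1 hn
    have : G.edgeSet = ∅ := by
      rw [edgeSet_eq_empty, eq_bot_iff]
      intro a b hab
      have h1 := hs ⟨b, hab⟩
      have h2 := hs ⟨a, hab.symm⟩
      exact hab.ne (h1.trans h2.symm)
    simp [this]
  | succ n ih =>
    intro G₀ s h5₀ hs₀ hn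
    by_contra! hcon
    obtain ⟨t, ht, hcard⟩ := Set.exists_subset_card_eq
      (s := G₀.edgeSet) (n := 3 * n + 4) (by omega)
    set G := fromEdgeSet t with hG
    have hle : G ≤ G₀ := by
      intro a b hab
      exact ht ((fromEdgeSet_adj t).1 hab).1
    have h5 : ¬ G.HasMinor (completeGraph (Fin 5)) := fun h => h5₀ (h.mono hle)
    have hs : G.support ⊆ s := (support_mono hle).trans hs₀
    have hE : G.edgeSet = t := by
      rw [hG, edgeSet_fromEdgeSet, sdiff_eq_left, Set.disjoint_left]
      intro e he
      exact G₀.not_isDiag_of_mem_edgeSet (ht he)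
    rw [← hE] at hcard
    obtain ⟨v, hv, hdeg⟩ := exists_ncard_neighborSet_le_five (G := G) (s := s) (by omega)
    have hers : ∀ u ∈ s, (s \ {u}).ncard = n + 1 := by
      intro u hu
      rw [Set.ncard_sdiff_singleton_of_mem hu]
      omega
    by_cases hx : ∃ x, G.Adj v x
    · obtain ⟨x, hx⟩ := hx
      refine h5 (hasMinor_K5_of_three_le_ncard_commonNeighbors hdeg hx fun u hu => ?_)
      have h1 := ncard_edgeSet_le_contractInto hu
      have h2 := ih (G := G.contractInto v u) (s := s \ {u}) (fun h => h5 (h.of_contractInto hu))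
        (by
          rintro a ⟨b, hau, -, -, h | ⟨rfl, h⟩ | ⟨rfl, h⟩⟩
          · exact ⟨hs ⟨b, h⟩, hau⟩
          · exact ⟨hv, hau⟩
          · exact ⟨hs ⟨u, h.symm⟩, hau⟩) (hers u (hs ⟨v, hu.symm⟩))
      omega
    · have := ih (G := G) (s := s \ {v}) h5
        (by
          rintro a ⟨b, h⟩
          exact ⟨hs ⟨b, h⟩, fun hav => hx ⟨b, hav ▸ h⟩⟩) (hers v hv)
      omega

/-- The subgraph formed by the edges lying on a 4-cycle. -/
def SimpleGraph.fourCycleGraph {V : Type*} (G : SimpleGraph V) : SimpleGraph V where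
  Adj x y := G.Adj x y ∧ ∃ z t, G.Adj y z ∧ G.Adj z t ∧ G.Adj t x ∧ x ≠ z ∧ y ≠ t
  symm := ⟨fun _ _ ⟨hxy, z, t, hyz, hzt, htx, hxz, hyt⟩ =>
    ⟨hxy.symm, t, z, htx.symm, hzt.symm, hyz.symm, hyt, hxz⟩⟩
  loopless := ⟨fun _ h => G.irrefl h.1⟩

theorem SimpleGraph.commonPairsExtend_fourCycleGraph {V : Type*} [Finite V] {G : SimpleGraph V}
    (h2 : 2 ∉ G.commA) : G.fourCycleGraph.CommonPairsExtend := by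
  intro x y p q hxy hpq hxp hyp hxq hyq
  have hsub : {p, q} ⊆ G.commonNeighbors x y := by
    rintro z (rfl | rfl)
    · exact ⟨hxp.1, hyp.1⟩
    · exact ⟨hxq.1, hyq.1⟩
  obtain ⟨r, hr, hrpq⟩ : ∃ r ∈ G.commonNeighbors x y, r ∉ ({p, q} : Set V) := by
    by_contra! hcon
    have heq : G.commonNeighbors x y = {p, q} := Set.Subset.antisymm hcon hsub
    exact h2 ⟨x, y, hxy, by rw [heq, Set.ncard_pair hpq]⟩
  simp only [Set.mem_insert_iff, Set.mem_singleton_iff, not_or] at hrpq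
  exact ⟨r, hrpq.1, hrpq.2,
    ⟨hr.1, y, p, hr.2.symm, hyp.1, hxp.1.symm, hxy, hrpq.1⟩,
    ⟨hr.2, x, p, hr.1.symm, hxp.1, hyp.1.symm, hxy.symm, hrpq.1⟩⟩

/-- For a finite planar graph `G`, `2 ∈ A(G)` iff `G`
contains a cycle of length `4`. -/
theorem stmt3 {V : Type*} [Fintype V] (G : SimpleGraph V) (hG : G.IsPlanar) :
    2 ∈ G.commA ↔ G.HasNCycle 4 := by
  rw [hasNCycle_four_iff]
  constructor
  · rintro ⟨x, z, hxz, hcard⟩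
    obtain ⟨y, t, hyt, heq⟩ := Set.ncard_eq_two.1 hcard
    have hy : y ∈ G.commonNeighbors x z := heq ▸ Set.mem_insert _ _
    have ht : t ∈ G.commonNeighbors x z := heq ▸ Set.mem_insert_of_mem _ rfl
    exact ⟨x, y, z, t, hy.1, hy.2.symm, ht.2, ht.1.symm, hxz, hyt⟩
  · rintro ⟨x, y, z, t, hxy, hyz, hzt, htx, hxz, hyt⟩
    by_contra h2
    set H := G.fourCycleGraph
    have hle : H ≤ G := fun _ _ h => h.1
    have h5 : ¬ H.HasMinor (completeGraph (Fin 5)) := fun h => hG.1 (h.mono hle)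
    have hmem : x ∈ H.support := ⟨y, hxy, z, t, hyz, hzt, htx, hxz, hyt⟩
    obtain ⟨n, hn⟩ : ∃ n, H.support.ncard = n + 1 :=
      Nat.exists_eq_add_one.2 ((Set.ncard_pos (Set.toFinite _)).2 ⟨x, hmem⟩)
    have := ncard_edgeSet_le_of_not_hasMinor_K5 n h5 subset_rfl hn
    obtain ⟨v, ⟨a, hva⟩, hdeg⟩ := exists_ncard_neighborSet_le_five (G := H) (s := H.support)
      (by omega)
    obtain ⟨hva', w, b, haw, hwb, hbv, hvw, hab⟩ := id hva
    exact hab (eq_of_two_common_of_ncard_neighborSet_le_five h5 (fun h => hG.2 (h.mono hle))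
      (commonPairsExtend_fourCycleGraph h2) hdeg hvw hva
      ⟨hbv.symm, w, a, hwb.symm, haw.symm, hva'.symm, hvw, hab.symm⟩
      ⟨haw.symm, v, b, hva'.symm, hbv.symm, hwb.symm, hvw.symm, hab⟩
      ⟨hwb, v, a, hbv, hva', haw, hvw.symm, hab.symm⟩)
end

section
/- If G is a polyhedron, then A(G) ≠ {1}; that is, it is impossible that every pair of distinct vertices of G has exactly one common neighbour. -/
open SimpleGraph

namespace SimpleGraph

variable {V : Type*} {G : SimpleGraph V}

/-- Any two distinct vertices have exactly one common neighbour. -/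
def IsFriendship (G : SimpleGraph V) : Prop :=
  ∀ ⦃u v : V⦄, u ≠ v → (G.commonNeighbors u v).ncard = 1

namespace IsFriendship

theorem exists_adj (h : G.IsFriendship) {u v : V} (huv : u ≠ v) :
    ∃ w, G.Adj u w ∧ G.Adj v w := by
  obtain ⟨w, hw⟩ := Set.ncard_eq_one.mp (h huv)
  exact ⟨w, G.mem_commonNeighbors.mp (hw ▸ Set.mem_singleton w)⟩

theorem adj_unique (h : G.IsFriendship) {u v x y : V} (huv : u ≠ v) (hux : G.Adj u x)
    (hvx : G.Adj v x) (huy : G.Adj u y) (hvy : G.Adj v y) : x = y := by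
  obtain ⟨w, hw⟩ := Set.ncard_eq_one.mp (h huv)
  have hx : x ∈ G.commonNeighbors u v := ⟨hux, hvx⟩
  have hy : y ∈ G.commonNeighbors u v := ⟨huy, hvy⟩
  rw [hw] at hx hy
  exact hx.trans hy.symm

/-- A vertex `v` adjacent to all others would leave a disjoint union of edges after its deletion. -/
theorem not_isKConnected_three [Fintype V] (h : G.IsFriendship) {v : V}
    (hv : ∀ w, v ≠ w → G.Adj v w) : ¬ G.IsKConnected 3 := by
  classical
  rintro ⟨hcard, hconn⟩
  obtain ⟨a, ha⟩ : ∃ a, a ∉ ({v} : Finset V) :=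
    Finset.exists_mem_notMem_of_card_lt_card (s := {v}) (t := Finset.univ)
      (by rw [Finset.card_univ, Finset.card_singleton]; omega) |>.imp fun _ ↦ And.right
  have hva : v ≠ a := by simpa [eq_comm] using ha
  obtain ⟨b, hvb, hab⟩ := h.exists_adj hva
  obtain ⟨c, hc⟩ : ∃ c, c ∉ ({v, a, b} : Finset V) :=
    Finset.exists_mem_notMem_of_card_lt_card (s := {v, a, b}) (t := Finset.univ)
      (by have := Finset.card_le_three (a := v) (b := a) (c := b)
          rw [Finset.card_univ]; omega) |>.imp fun _ ↦ And.right
  simp only [Finset.mem_insert, Finset.mem_singleton, not_or] at hc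
  have hS := hconn {v, b} (by rw [Set.ncard_pair hvb.ne]; omega)
  obtain ⟨p⟩ := hS.preconnected ⟨a, by simp [hva.symm, hab.ne]⟩ ⟨c, by simp [hc]⟩
  cases p with
  | nil => exact hc.2.1 rfl
  | @cons _ x _ hax _ =>
    obtain ⟨-, -, -, hx, hax⟩ := Subgraph.deleteVerts_adj.mp hax
    simp only [Set.mem_insert_iff, Set.mem_singleton_iff, not_or] at hx
    exact hx.2 (h.adj_unique hva (hv _ (Ne.symm hx.1)) hax hvb hab)

variable [Fintype V] [DecidableRel G.Adj]

theorem card_commonNeighbors (h : G.IsFriendship) {u v : V} (huv : u ≠ v) :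
    Fintype.card (G.commonNeighbors u v) = 1 := by
  rw [← Nat.card_eq_fintype_card, Nat.card_coe_set_eq, h huv]

theorem isSRGWith (h : G.IsFriendship) {d : ℕ} (hd : G.IsRegularOfDegree d) :
    G.IsSRGWith (Fintype.card V) d 1 1 where
  card := rfl
  regular := hd
  of_adj _ _ hvw := h.card_commonNeighbors hvw.ne
  of_not_adj _ _ hvw _ := h.card_commonNeighbors hvw

variable [DecidableEq V]

theorem adjMatrix_mul_self_apply (h : G.IsFriendship) {u v : V} (huv : u ≠ v) :
    (G.adjMatrix ℕ * G.adjMatrix ℕ) u v = 1 := by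
  rw [← pow_two, adjMatrix_pow_apply_eq_card_walk, ← h.card_commonNeighbors huv, Nat.cast_id]
  exact Fintype.card_congr (G.walkLengthTwoEquivCommonNeighbors u v)

/-- Both degrees count the walks of length three from `u` to `v`. -/
theorem degree_eq_of_not_adj (h : G.IsFriendship) {u v : V} (huv : ¬ G.Adj u v) :
    G.degree u = G.degree v := by
  have hl : (G.adjMatrix ℕ * (G.adjMatrix ℕ * G.adjMatrix ℕ)) u v = G.degree u := by
    rw [adjMatrix_mul_apply, Finset.sum_congr rfl fun x hx ↦ h.adjMatrix_mul_self_apply ?_]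
    · simp
    · rintro rfl
      exact huv (by simpa using hx)
  have hr : (G.adjMatrix ℕ * G.adjMatrix ℕ * G.adjMatrix ℕ) u v = G.degree v := by
    rw [mul_adjMatrix_apply, Finset.sum_congr rfl fun x hx ↦ h.adjMatrix_mul_self_apply ?_]
    · simp
    · rintro rfl
      exact huv (by simpa [adj_comm] using hx)
  rw [← hl, ← hr, mul_assoc]

theorem degree_eq (h : G.IsFriendship) (huniv : ∀ v, ∃ w, v ≠ w ∧ ¬ G.Adj v w) (v w : V) :
    G.degree v = G.degree w := by
  by_contra hne
  have hvw : G.Adj v w := by_contra fun hn ↦ hne (h.degree_eq_of_not_adj hn)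
  obtain ⟨y, hvy, hwy⟩ := h.exists_adj hvw.ne
  have key : ∀ {a b c : V}, G.Adj a b → G.Adj a c → G.Adj b c → G.degree a ≠ G.degree b →
      G.degree a ≠ G.degree c → False := by
    intro a b c hab hac hbc hdb hdc
    obtain ⟨x, hax, hnax⟩ := huniv a
    have hdx := h.degree_eq_of_not_adj hnax
    have hbx : G.Adj b x := by_contra fun hn ↦ hdb (hdx.trans (h.degree_eq_of_not_adj hn).symm)
    have hcx : G.Adj c x := by_contra fun hn ↦ hdc (hdx.trans (h.degree_eq_of_not_adj hn).symm)
    exact hax (h.adj_unique hbc.ne hab.symm hac.symm hbx hcx)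
  by_cases hy : G.degree v = G.degree y
  · exact key hvw.symm hwy hvy (Ne.symm hne) (hy ▸ Ne.symm hne)
  · exact key hvw hvy hwy hne hy

theorem adjMatrix_sq (h : G.IsFriendship) {d : ℕ} (hd : G.IsRegularOfDegree d)
    {R : Type*} [CommRing R] :
    G.adjMatrix R ^ 2 = ((d : R) - 1) • 1 + Matrix.of 1 := by
  classical
  rw [(h.isSRGWith hd).matrix_eq, ← G.one_add_adjMatrix_add_compl_adjMatrix_eq_of_one (α := R),
    compl_adjMatrix_eq_adjMatrix_compl, sub_smul]
  simp only [Nat.cast_smul_eq_nsmul, one_smul]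
  abel

theorem not_isRegularOfDegree (h : G.IsFriendship) (hcard : 4 ≤ Fintype.card V) (d : ℕ) :
    ¬ G.IsRegularOfDegree d := by
  intro hd
  have hparam := (h.isSRGWith hd).param_eq _ (by omega)
  have hd3 : 3 ≤ d := by
    by_contra! hlt
    interval_cases d <;> omega
  obtain ⟨e, rfl⟩ : ∃ e, d = e + 1 := ⟨d - 1, by omega⟩
  have hn : Fintype.card V = e * (e + 1) + 1 := by
    obtain ⟨f, rfl⟩ : ∃ f, e = f + 2 := ⟨e - 2, by omega⟩
    have hsub : (f + 3) * (f + 1) = Fintype.card V - (f + 3) - 1 := by simpa using hparam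
    have hcard' : Fintype.card V = (f + 3) * (f + 1) + (f + 4) := by
      have : 0 < (f + 3) * (f + 1) := by positivity
      omega
    rw [hcard']
    ring
  have hp : Fact e.minFac.Prime := ⟨Nat.minFac_prime (by omega)⟩
  set p := e.minFac
  have he : (e : ZMod p) = 0 := (ZMod.natCast_eq_zero_iff _ _).mpr e.minFac_dvd
  have hpow : ∀ k, G.adjMatrix (ZMod p) ^ (k + 2) = Matrix.of 1 := by
    intro k
    induction k with
    | zero => simp [h.adjMatrix_sq hd, he]
    | succ k ih =>
      rw [add_right_comm, pow_succ', ih]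
      ext u v
      simp [hd u, he]
  have htrace := ZMod.trace_pow_card (G.adjMatrix (ZMod p))
  obtain ⟨k, hk⟩ := Nat.exists_eq_add_of_le' hp.out.two_le
  have hJ : G.adjMatrix (ZMod p) ^ p = Matrix.of 1 :=
    (congrArg (G.adjMatrix (ZMod p) ^ ·) hk).trans (hpow k)
  rw [trace_adjMatrix, zero_pow hp.out.ne_zero, hJ] at htrace
  simp [Matrix.trace, hn, he] at htrace

end IsFriendship

end SimpleGraph

/-- If `G` is a polyhedron, then `A(G) ≠ {1}`. -/
theorem stmt6 {V : Type*} [Fintype V] (G : SimpleGraph V) (hG : G.IsPolyhedron) :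
    G.commA ≠ {1} := by
  classical
  intro hA
  have h : G.IsFriendship := fun u v huv ↦ by
    have : (G.commonNeighbors u v).ncard ∈ G.commA := ⟨u, v, huv, rfl⟩
    rwa [hA] at this
  have hcard := hG.2.1
  by_cases huniv : ∀ v, ∃ w, v ≠ w ∧ ¬ G.Adj v w
  · obtain ⟨v⟩ : Nonempty V := Fintype.card_pos_iff.mp (by omega)
    exact h.not_isRegularOfDegree hcard _ fun w ↦ h.degree_eq huniv w v
  · push Not at huniv
    obtain ⟨v, hv⟩ := huniv
    exact h.not_isKConnected_three hv hG.2
end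

section
/- Let G be a polyhedron. Then A(G) = {0,1} if and only if G does not contain any cycle of length 4. -/
open SimpleGraph

namespace SimpleGraph

variable {V : Type*} {G : SimpleGraph V}

/-- A graph contains a 4-cycle iff some two distinct vertices have two distinct common
neighbours. -/
theorem hasNCycle_four_iff_s7 :
    G.HasNCycle 4 ↔ ∃ u v, u ≠ v ∧ (G.commonNeighbors u v).Nontrivial := by
  constructor
  · rintro ⟨u, c, hc, hl⟩
    match c, hc, hl with
    | .cons (v := p) h₁ (.cons (v := v) h₂ (.cons (v := q) h₃ (.cons h₄ .nil))), hc, _ =>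
      have hn := hc.support_nodup
      simp only [Walk.support_cons, Walk.support_nil, List.tail_cons, List.nodup_cons,
        List.mem_cons, List.not_mem_nil, or_false, not_or] at hn
      exact ⟨u, v, Ne.symm hn.2.1.2, p, ⟨h₁, h₂.symm⟩, q, ⟨h₄.symm, h₃⟩, hn.1.2.1⟩
  · rintro ⟨u, v, huv, p, ⟨hup, hvp⟩, q, ⟨huq, hvq⟩, hpq⟩
    rw [mem_neighborSet] at hup hvp huq hvq
    refine ⟨u, .cons hup (.cons hvp.symm (.cons hvq (.cons huq.symm .nil))), ?_, rfl⟩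
    have := hup.ne
    have := hvp.ne
    have := huq.ne
    have := hvq.ne
    simp [Walk.cons_isCycle_iff]
    grind

/-- Every vertex of a `k`-connected graph has at least `k` neighbours. -/
theorem IsKConnected.le_ncard_neighborSet [Fintype V] {k : ℕ} (hG : G.IsKConnected k) (v : V) :
    k ≤ (G.neighborSet v).ncard := by
  by_contra! hlt
  have hconn := hG.2 _ hlt
  obtain ⟨w, hw⟩ : ∃ w, w ∉ insert v (G.neighborSet v) := by
    by_contra! hall
    have hle := Set.ncard_insert_le v (G.neighborSet v)
    rw [Set.eq_univ_of_forall hall, Set.ncard_univ, Nat.card_eq_fintype_card] at hle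
    have := hG.1
    omega
  rw [Set.mem_insert_iff, not_or] at hw
  have hne : (⟨v, by simp⟩ : ((⊤ : G.Subgraph).deleteVerts (G.neighborSet v)).verts) ≠
      ⟨w, by simpa using hw.2⟩ := fun h => hw.1 (congrArg Subtype.val h).symm
  obtain ⟨p⟩ := hconn.preconnected ⟨v, by simp⟩ ⟨w, by simpa using hw.2⟩
  cases p with
  | nil => exact hne rfl
  | @cons _ x _ h _ =>
    have hx := x.2.2
    exact hx (Subgraph.coe_adj_sub _ _ _ h)

/-- The neighbour `c` of `v`, together with the neighbours of `c` at distance two from `v`. -/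
def branch (G : SimpleGraph V) (v c : V) : Set V :=
  insert c {x | x ≠ v ∧ G.Adj c x ∧ ¬ G.Adj v x}

theorem connected_induce_branch (v c : V) : (G.induce (G.branch v c)).Connected := by
  have hc : c ∈ G.branch v c := Set.mem_insert _ _
  refine connected_iff_exists_forall_reachable _ |>.2 ⟨⟨c, hc⟩, ?_⟩
  rintro ⟨x, rfl | hx⟩
  · exact Reachable.refl _
  · exact Adj.reachable (by simpa using hx.2.1)

/-- A graph of minimum degree at least three in which any two distinct vertices have exactly one
common neighbour has a `K₅` minor. -/
theorem hasMinor_completeGraph_five_of_friendship [Finite V] [Nonempty V]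
    (hdeg : ∀ v, 3 ≤ (G.neighborSet v).ncard)
    (hex : ∀ u v, u ≠ v → (G.commonNeighbors u v).Nonempty)
    (huniq : ∀ u v, u ≠ v → (G.commonNeighbors u v).Subsingleton) :
    G.HasMinor (completeGraph (Fin 5)) := by
  have huniq' : ∀ {u v x y}, u ≠ v → G.Adj u x → G.Adj v x → G.Adj u y → G.Adj v y → x = y :=
    fun h h₁ h₂ h₃ h₄ => huniq _ _ h ⟨h₁, h₂⟩ ⟨h₃, h₄⟩
  have third : ∀ v p q, ∃ x, G.Adj v x ∧ x ≠ p ∧ x ≠ q := by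
    intro v p q
    obtain ⟨x, hx, hn⟩ := Set.exists_mem_notMem_of_ncard_lt_ncard
      (s := {p, q}) (t := G.neighborSet v) (by
        have := Set.ncard_insert_le p {q}
        have := hdeg v
        rw [Set.ncard_singleton] at *
        omega)
    simp only [Set.mem_insert_iff, Set.mem_singleton_iff, not_or] at hn
    exact ⟨x, hx, hn⟩
  obtain ⟨v⟩ := ‹Nonempty V›
  obtain ⟨a, hva, -, -⟩ := third v v v
  obtain ⟨a', hva', haa'⟩ := hex v a hva.ne
  obtain ⟨b, hvb, hba, hba'⟩ := third v a a'
  obtain ⟨b', hvb', hbb'⟩ := hex v b hvb.ne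
  rw [mem_neighborSet] at hva' haa' hvb' hbb'
  have hb'a : b' ≠ a := by
    rintro rfl
    exact hba' (huniq' hva.ne hvb hbb'.symm hva' haa')
  have hb'a' : b' ≠ a' := by
    rintro rfl
    exact hba (huniq' hva'.ne hvb hbb'.symm hva haa'.symm)
  have hdisj : ∀ {c d}, G.Adj v c → G.Adj v d → c ≠ d →
      Disjoint (G.branch v c) (G.branch v d) := by
    intro c d hc hd hcd
    rw [Set.disjoint_left]
    rintro x (rfl | ⟨hxv, hcx, hvx⟩) (rfl | ⟨hxv', hdx, hvx'⟩)
    · exact hcd rfl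
    · exact hvx' hc
    · exact hvx hd
    · exact hcd (huniq' hxv hcx.symm hc hdx.symm hd)
  have hadj : ∀ {c d}, G.Adj v c → G.Adj v d → c ≠ d →
      ∃ x ∈ G.branch v c, ∃ y ∈ G.branch v d, G.Adj x y := by
    intro c d hc hd hcd
    by_cases h : G.Adj c d
    · exact ⟨c, Set.mem_insert _ _, d, Set.mem_insert _ _, h⟩
    obtain ⟨c', hvc', hcc'⟩ := hex v c hc.ne
    rw [mem_neighborSet] at hvc' hcc'
    obtain ⟨x, hcx, hxv, hxc'⟩ := third c v c'
    have hvx : ¬ G.Adj v x := fun hvx => hxc' (huniq' hc.ne hvx hcx hvc' hcc')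
    obtain ⟨y, hxy, hdy⟩ := hex x d (by rintro rfl; exact hvx hd)
    rw [mem_neighborSet] at hxy hdy
    refine ⟨x, Or.inr ⟨hxv, hcx, hvx⟩, y, Or.inr ⟨?_, hdy, fun hvy => ?_⟩, hxy⟩
    · rintro rfl
      exact hvx hxy.symm
    · obtain rfl := huniq' hxv hxy hvy hcx.symm hc
      exact h hdy.symm
  let g : Fin 4 → V := ![a, a', b, b']
  have hg : ∀ i, G.Adj v (g i) := by
    intro i
    fin_cases i <;> assumption
  have hinj : g.Injective := by
    have := haa'.ne
    have := hbb'.ne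
    intro i j hij
    fin_cases i <;> fin_cases j <;> simp [g] at hij ⊢ <;> grind
  have hv : ∀ i, v ∉ G.branch v (g i) := by
    rintro i (h | h)
    · exact (hg i).ne h
    · exact h.1 rfl
  refine ⟨Fin.cons {v} fun i => G.branch v (g i), ?_, ?_, ?_⟩
  · intro w
    refine Fin.cases ?_ (fun i => ?_) w
    · exact @Connected.of_subsingleton _ _ ⟨⟨v, rfl⟩⟩ (Set.subsingleton_coe _ |>.2 Set.subsingleton_singleton)
    · exact connected_induce_branch v (g i)
  · intro w₁ w₂ h
    induction w₁ using Fin.cases with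
    | zero =>
      induction w₂ using Fin.cases with
      | zero => exact absurd rfl h
      | succ j => simpa using hv j
    | succ i =>
      induction w₂ using Fin.cases with
      | zero => simpa using hv i
      | succ j => exact hdisj (hg i) (hg j) fun e => h (congrArg Fin.succ (hinj e))
  · intro w₁ w₂ h
    replace h : w₁ ≠ w₂ := h.ne
    induction w₁ using Fin.cases with
    | zero =>
      induction w₂ using Fin.cases with
      | zero => exact absurd rfl h
      | succ j => exact ⟨v, rfl, g j, Set.mem_insert _ _, hg j⟩
    | succ i =>
      induction w₂ using Fin.cases with
      | zero => exact ⟨g i, Set.mem_insert _ _, v, rfl, (hg i).symm⟩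
      | succ j => exact hadj (hg i) (hg j) fun e => h (congrArg Fin.succ (hinj e))

end SimpleGraph

/-- For a polyhedron `G`, `A(G) = {0,1}` iff `G` contains no
cycle of length `4`. -/
theorem stmt7 {V : Type*} [Fintype V] (G : SimpleGraph V) (hG : G.IsPolyhedron) :
    G.commA = {0, 1} ↔ ¬ G.HasNCycle 4 := by
  rw [hasNCycle_four_iff_s7]
  constructor
  · rintro hA ⟨u, v, huv, hnt⟩
    have hmem : (G.commonNeighbors u v).ncard ∈ G.commA := ⟨u, v, huv, rfl⟩
    have hlt := Set.one_lt_ncard_iff_nontrivial.2 hnt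
    rw [hA, Set.mem_insert_iff, Set.mem_singleton_iff] at hmem
    omega
  · intro hno
    have huniq : ∀ u v, u ≠ v → (G.commonNeighbors u v).Subsingleton := fun u v huv =>
      Set.not_nontrivial_iff.1 fun h => hno ⟨u, v, huv, h⟩
    have hdeg := hG.2.le_ncard_neighborSet
    have : Nonempty V := Fintype.card_pos_iff.1 (by have := hG.2.1; omega)
    refine Set.Subset.antisymm ?_ (Set.pair_subset ?_ ?_)
    · rintro _ ⟨u, v, huv, rfl⟩
      have := Set.ncard_le_one_iff_subsingleton.2 (huniq u v huv)
      rw [Set.mem_insert_iff, Set.mem_singleton_iff]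
      omega
    · by_contra h0
      refine hG.1.1 (hasMinor_completeGraph_five_of_friendship hdeg (fun u v huv => ?_) huniq)
      by_contra hempty
      exact h0 ⟨u, v, huv, by rw [Set.not_nonempty_iff_eq_empty.1 hempty, Set.ncard_empty]⟩
    · obtain ⟨w⟩ := this
      obtain ⟨u, hu, v, hv, huv⟩ := (Set.one_lt_ncard (Set.toFinite _)).1
        (show 1 < (G.neighborSet w).ncard by have := hdeg w; omega)
      refine ⟨u, v, huv, Set.ncard_eq_one.2 ⟨w, ?_⟩⟩
      exact (huniq u v huv).eq_singleton_of_mem ⟨Adj.symm hu, Adj.symm hv⟩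
end
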